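/- arXiv:1112.4954 — 3 statements merged into one kernel-verified Lean document; each statement's English description precedes it below -/
import Mathlib

section
/- For n ≥ 2, the following equalities hold in Br(B_n): (i) e_1e_0e_1 = e_1r_0e_1; (ii) r_0e_1e_0 = e_1e_0; (iii) e_0r_1r_0e_1 = e_0e_1; (iv) r_1r_0e_1r_0 = r_0e_1r_0r_1; (v) e_1r_0e_1r_0 = e_1e_0e_1. -/
/-- The ground ring `ℤ[δ, δ⁻¹]` of Laurent polynomials over `ℤ`. -/
abbrev Lp : Type := LaurentPolynomial ℤ

/-- The parameter `δ`. -/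
noncomputable def δpar : Lp := LaurentPolynomial.T 1

/-- Generators of the Brauer algebra of type `B_n`: `r i` and `e i` for `0 ≤ i ≤ n-1`. -/
inductive BGen (n : ℕ) : Type
  | r (i : Fin n) : BGen n
  | e (i : Fin n) : BGen n

/-- The generator `r i` viewed in the free algebra. -/
noncomputable def fr {n : ℕ} (i : Fin n) : FreeAlgebra Lp (BGen n) :=
  FreeAlgebra.ι Lp (BGen.r i)

/-- The generator `e i` viewed in the free algebra. -/
noncomputable def fe {n : ℕ} (i : Fin n) : FreeAlgebra Lp (BGen n) :=
  FreeAlgebra.ι Lp (BGen.e i)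

/-- The defining relations of the Brauer algebra of type `B_n`. -/
inductive BrauerBRel (n : ℕ) : FreeAlgebra Lp (BGen n) → FreeAlgebra Lp (BGen n) → Prop
  | rr (i : Fin n) : BrauerBRel n (fr i * fr i) 1
  | re (i : Fin n) : BrauerBRel n (fr i * fe i) (fe i)
  | er (i : Fin n) : BrauerBRel n (fe i * fr i) (fe i)
  | ee (i : Fin n) (h : 0 < i.val) : BrauerBRel n (fe i * fe i) (δpar • fe i)
  | e0e0 (i : Fin n) (h : i.val = 0) : BrauerBRel n (fe i * fe i) ((δpar * δpar) • fe i)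
  | rrFar (i j : Fin n) (h : i.val + 2 ≤ j.val ∨ j.val + 2 ≤ i.val) :
      BrauerBRel n (fr i * fr j) (fr j * fr i)
  | erFar (i j : Fin n) (h : i.val + 2 ≤ j.val ∨ j.val + 2 ≤ i.val) :
      BrauerBRel n (fe i * fr j) (fr j * fe i)
  | eeFar (i j : Fin n) (h : i.val + 2 ≤ j.val ∨ j.val + 2 ≤ i.val) :
      BrauerBRel n (fe i * fe j) (fe j * fe i)
  | braid (i j : Fin n) (h : i.val + 1 = j.val ∨ j.val + 1 = i.val)
      (hi : 0 < i.val) (hj : 0 < j.val) :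
      BrauerBRel n (fr i * fr j * fr i) (fr j * fr i * fr j)
  | rre (i j : Fin n) (h : i.val + 1 = j.val ∨ j.val + 1 = i.val)
      (hi : 0 < i.val) (hj : 0 < j.val) :
      BrauerBRel n (fr j * fr i * fe j) (fe i * fe j)
  | rer (i j : Fin n) (h : i.val + 1 = j.val ∨ j.val + 1 = i.val)
      (hi : 0 < i.val) (hj : 0 < j.val) :
      BrauerBRel n (fr i * fe j * fr i) (fr j * fe i * fr j)
  | b1010 (i j : Fin n) (h0 : i.val = 0) (h1 : j.val = 1) :
      BrauerBRel n (fr j * fr i * fr j * fr i) (fr i * fr j * fr i * fr j)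
  | b_r0r1e0 (i j : Fin n) (h0 : i.val = 0) (h1 : j.val = 1) :
      BrauerBRel n (fr i * fr j * fe i) (fr j * fe i)
  | b_r0e1r0e1 (i j : Fin n) (h0 : i.val = 0) (h1 : j.val = 1) :
      BrauerBRel n (fr i * fe j * fr i * fe j) (fe j * fe i * fe j)
  | b_r0r1r0e1 (i j : Fin n) (h0 : i.val = 0) (h1 : j.val = 1) :
      BrauerBRel n (fr i * fr j * fr i * fe j) (fe j * (fr i * fr j * fr i))
  | b_e0r1e0 (i j : Fin n) (h0 : i.val = 0) (h1 : j.val = 1) :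
      BrauerBRel n (fe i * fr j * fe i) (δpar • fe i)
  | b_e0e1e0 (i j : Fin n) (h0 : i.val = 0) (h1 : j.val = 1) :
      BrauerBRel n (fe i * fe j * fe i) (δpar • fe i)
  | b_e0r1r0 (i j : Fin n) (h0 : i.val = 0) (h1 : j.val = 1) :
      BrauerBRel n (fe i * fr j * fr i) (fe i * fr j)
  | b_e0e1r0 (i j : Fin n) (h0 : i.val = 0) (h1 : j.val = 1) :
      BrauerBRel n (fe i * fe j * fr i) (fe i * fe j)

/-- The Brauer algebra of type `B_n` over `ℤ[δ, δ⁻¹]`. -/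
abbrev BrauerB (n : ℕ) : Type := RingQuot (BrauerBRel n)

/-- The generator `r i` of `Br(B_n)` (defined to be `1` for out-of-range indices). -/
noncomputable def rb (n : ℕ) (i : ℕ) : BrauerB n :=
  if h : i < n then RingQuot.mkAlgHom Lp (BrauerBRel n) (fr ⟨i, h⟩) else 1

/-- The generator `e i` of `Br(B_n)` (defined to be `1` for out-of-range indices). -/
noncomputable def eb (n : ℕ) (i : ℕ) : BrauerB n :=
  if h : i < n then RingQuot.mkAlgHom Lp (BrauerBRel n) (fe ⟨i, h⟩) else 1


theorem isUnit_δpar : IsUnit δpar :=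
  LaurentPolynomial.isUnit_T 1

section Abstract

variable {K A : Type*} [CommSemiring K] [Semiring A] [Algebra K A] {d : K} {r e f : A}

theorem mul_mul_eq_of_conj (rr : r * r = 1) (rfrf : r * f * r * f = f * e * f) :
    r * (f * e * f) = f * r * f := by
  rw [← rfrf]
  simp only [← mul_assoc, rr, one_mul]

theorem mul_mul_mul_eq_of_conj (rr : r * r = 1) (rfrf : r * f * r * f = f * e * f)
    (efr : e * f * r = e * f) : f * r * f * r = f * r * f := by
  rw [← mul_mul_eq_of_conj rr rfrf]
  simp only [mul_assoc] at efr ⊢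
  rw [efr]

theorem sandwich_eq_of_conj (hd : IsUnit d) (rr : r * r = 1) (ff : f * f = d • f)
    (rfrf : r * f * r * f = f * e * f) (efr : e * f * r = e * f) :
    f * e * f = f * r * f := by
  apply hd.smul_left_cancel.mp
  calc d • (f * e * f) = f * (f * e * f) := by
        rw [← mul_assoc, ← mul_assoc, ff, smul_mul_assoc, smul_mul_assoc]
    _ = f * r * f * r * f := by rw [← rfrf]; simp only [mul_assoc]
    _ = f * r * f * f := by rw [mul_mul_mul_eq_of_conj rr rfrf efr]
    _ = d • (f * r * f) := by rw [mul_assoc _ f f, ff, mul_smul_comm]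

theorem left_absorb_of_conj (hd : IsUnit d) (rr : r * r = 1) (ff : f * f = d • f)
    (rfrf : r * f * r * f = f * e * f) (efr : e * f * r = e * f) (efe : e * f * e = d • e) :
    r * f * e = f * e := by
  have fefe : f * e * f * e = d • (f * e) := by
    rw [mul_assoc, mul_assoc, ← mul_assoc e, efe, mul_smul_comm]
  apply hd.smul_left_cancel.mp
  calc d • (r * f * e) = r * (f * e * f) * e := by
        rw [mul_assoc r (f * e * f) e, fefe, mul_smul_comm, mul_assoc]
    _ = f * e * f * e := by
        rw [mul_mul_eq_of_conj rr rfrf, sandwich_eq_of_conj hd rr ff rfrf efr]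
    _ = d • (f * e) := fefe

theorem conj_comm_of_comm_conj {s : A} (rr : r * r = 1)
    (h : r * s * r * f = f * (r * s * r)) : s * r * f * r = r * f * r * s :=
  calc s * r * f * r = r * r * (s * r * f * r) := by rw [rr, one_mul]
    _ = r * (r * s * r * f) * r := by simp only [mul_assoc]
    _ = r * f * r * s * (r * r) := by rw [h]; simp only [mul_assoc]
    _ = r * f * r * s := by rw [rr, mul_one]

end Abstract

/-- For `n ≥ 2`, the following equalities hold in `Br(B_n)`:
(i) `e₁e₀e₁ = e₁r₀e₁`; (ii) `r₀e₁e₀ = e₁e₀`; (iii) `e₀r₁r₀e₁ = e₀e₁`;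
(iv) `r₁r₀e₁r₀ = r₀e₁r₀r₁`; (v) `e₁r₀e₁r₀ = e₁e₀e₁`. -/
theorem statement_3 (n : ℕ) (hn : 2 ≤ n) :
    eb n 1 * eb n 0 * eb n 1 = eb n 1 * rb n 0 * eb n 1 ∧
    rb n 0 * eb n 1 * eb n 0 = eb n 1 * eb n 0 ∧
    eb n 0 * rb n 1 * rb n 0 * eb n 1 = eb n 0 * eb n 1 ∧
    rb n 1 * rb n 0 * eb n 1 * rb n 0 = rb n 0 * eb n 1 * rb n 0 * rb n 1 ∧
    eb n 1 * rb n 0 * eb n 1 * rb n 0 = eb n 1 * eb n 0 * eb n 1 := by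
  have h0 : 0 < n := by omega
  have h1 : 1 < n := by omega
  simp only [eb, rb, h0, h1, dif_pos]
  let i : Fin n := ⟨0, h0⟩
  let j : Fin n := ⟨1, h1⟩
  have rr := RingQuot.mkAlgHom_rel Lp (BrauerBRel.rr i)
  have sf := RingQuot.mkAlgHom_rel Lp (BrauerBRel.re j)
  have ff := RingQuot.mkAlgHom_rel Lp (BrauerBRel.ee j Nat.one_pos)
  have rfrf := RingQuot.mkAlgHom_rel Lp (BrauerBRel.b_r0e1r0e1 i j rfl rfl)
  have rsrf := RingQuot.mkAlgHom_rel Lp (BrauerBRel.b_r0r1r0e1 i j rfl rfl)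
  have efe := RingQuot.mkAlgHom_rel Lp (BrauerBRel.b_e0e1e0 i j rfl rfl)
  have esr := RingQuot.mkAlgHom_rel Lp (BrauerBRel.b_e0r1r0 i j rfl rfl)
  have efr := RingQuot.mkAlgHom_rel Lp (BrauerBRel.b_e0e1r0 i j rfl rfl)
  simp only [map_mul, map_one, map_smul] at rr sf ff rfrf rsrf efe esr efr
  have fef := sandwich_eq_of_conj isUnit_δpar rr ff rfrf efr
  refine ⟨fef, left_absorb_of_conj isUnit_δpar rr ff rfrf efr efe, ?_, ?_, ?_⟩
  · rw [esr, mul_assoc, sf]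
  · exact conj_comm_of_comm_conj rr rsrf
  · rw [mul_mul_mul_eq_of_conj rr rfrf efr]
    exact fef.symm
end

section
/- There is a unique ℤ[δ,δ⁻¹]-algebra homomorphism φ: Br(B_n) → Br(D_{n+1}) with φ(r_0) = R_1R_2, φ(r_i) = R_{i+2} for 1 ≤ i ≤ n−1, φ(e_0) = E_1E_2, and φ(e_i) = E_{i+2} for 1 ≤ i ≤ n−1; moreover the image of φ is contained in the symmetric subalgebra SBr(D_{n+1}). -/
/-- Generators of the Brauer algebra of a simply-laced graph `Q`. -/
inductive QGen (V : Type) : Type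
  | R (i : V) : QGen V
  | E (i : V) : QGen V

noncomputable def fR {V : Type} (i : V) : FreeAlgebra Lp (QGen V) :=
  FreeAlgebra.ι Lp (QGen.R i)
noncomputable def fE {V : Type} (i : V) : FreeAlgebra Lp (QGen V) :=
  FreeAlgebra.ι Lp (QGen.E i)

/-- The defining relations of the Brauer algebra `Br(Q)` of a graph `Q`. -/
inductive BrauerQRel {V : Type} (G : SimpleGraph V) :
    FreeAlgebra Lp (QGen V) → FreeAlgebra Lp (QGen V) → Prop
  | RR (i : V) : BrauerQRel G (fR i * fR i) 1
  | EE (i : V) : BrauerQRel G (fE i * fE i) (δpar • fE i)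
  | RE (i : V) : BrauerQRel G (fR i * fE i) (fE i)
  | ER (i : V) : BrauerQRel G (fE i * fR i) (fE i)
  | RRfar (i j : V) (hne : i ≠ j) (h : ¬ G.Adj i j) :
      BrauerQRel G (fR i * fR j) (fR j * fR i)
  | ERfar (i j : V) (hne : i ≠ j) (h : ¬ G.Adj i j) :
      BrauerQRel G (fE i * fR j) (fR j * fE i)
  | EEfar (i j : V) (hne : i ≠ j) (h : ¬ G.Adj i j) :
      BrauerQRel G (fE i * fE j) (fE j * fE i)
  | braid (i j : V) (h : G.Adj i j) :
      BrauerQRel G (fR i * fR j * fR i) (fR j * fR i * fR j)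
  | RRE (i j : V) (h : G.Adj i j) :
      BrauerQRel G (fR j * fR i * fE j) (fE i * fE j)
  | RER (i j : V) (h : G.Adj i j) :
      BrauerQRel G (fR i * fE j * fR i) (fR j * fE i * fR j)

/-- The Brauer algebra `Br(Q)` of a graph `Q` over `ℤ[δ, δ⁻¹]`. -/
abbrev BrauerQ {V : Type} (G : SimpleGraph V) : Type := RingQuot (BrauerQRel G)

/-- The generator `R i` of `Br(Q)`. -/
noncomputable def genR {V : Type} (G : SimpleGraph V) (i : V) : BrauerQ G :=
  RingQuot.mkAlgHom Lp (BrauerQRel G) (fR i)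

/-- The generator `E i` of `Br(Q)`. -/
noncomputable def genE {V : Type} (G : SimpleGraph V) (i : V) : BrauerQ G :=
  RingQuot.mkAlgHom Lp (BrauerQRel G) (fE i)

/-- The Coxeter graph `D_{n+1}`, on vertices `0, …, n` (corresponding to the nodes
`1, …, n+1` of the paper): edges `{0,2}`, `{1,2}` and `{i, i+1}` for `2 ≤ i ≤ n-1`. -/
def Dgraph (n : ℕ) : SimpleGraph (Fin (n + 1)) :=
  SimpleGraph.fromRel (fun i j =>
    (i.val = 0 ∧ j.val = 2) ∨ (i.val = 1 ∧ j.val = 2) ∨ (2 ≤ i.val ∧ j.val = i.val + 1))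

/-- The Brauer monoid `BrM(D_{n+1})`: the multiplicative submonoid of `Br(D_{n+1})`
generated by `δ`, `δ⁻¹` and all the generators `R_i`, `E_i`. -/
noncomputable def BrMD (n : ℕ) : Submonoid (BrauerQ (Dgraph n)) :=
  Submonoid.closure
    ({algebraMap Lp _ (LaurentPolynomial.T 1), algebraMap Lp _ (LaurentPolynomial.T (-1))} ∪
      Set.range (genR (Dgraph n)) ∪ Set.range (genE (Dgraph n)))

/-- The predicate expressing that `σ` is the diagram automorphism of `Br(D_{n+1})`:
it swaps `R_1 ↔ R_2`, `E_1 ↔ E_2` (vertices `0` and `1` here) and fixes all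
other generators. -/
def IsDiagramAut (n : ℕ) (σ : BrauerQ (Dgraph n) ≃ₐ[Lp] BrauerQ (Dgraph n)) : Prop :=
  σ (genR (Dgraph n) 0) = genR (Dgraph n) 1 ∧
  σ (genR (Dgraph n) 1) = genR (Dgraph n) 0 ∧
  σ (genE (Dgraph n) 0) = genE (Dgraph n) 1 ∧
  σ (genE (Dgraph n) 1) = genE (Dgraph n) 0 ∧
  ∀ i : Fin (n + 1), 2 ≤ i.val →
    σ (genR (Dgraph n) i) = genR (Dgraph n) i ∧ σ (genE (Dgraph n) i) = genE (Dgraph n) i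

/-- The symmetric subalgebra `SBr(D_{n+1})`: the `ℤ[δ,δ⁻¹]`-span of the monomials
in `BrM(D_{n+1})` fixed by the diagram automorphism `σ`. -/
noncomputable def SBrD (n : ℕ) (σ : BrauerQ (Dgraph n) ≃ₐ[Lp] BrauerQ (Dgraph n)) :
    Submodule Lp (BrauerQ (Dgraph n)) :=
  Submodule.span Lp {x | x ∈ BrMD n ∧ σ x = x}


/-- The predicate expressing that `φ : Br(B_n) → Br(D_{n+1})` takes the prescribed
values on the generators: `φ(r₀) = R_1R_2`, `φ(e₀) = E_1E_2` (vertices `0`, `1` here),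
and `φ(r_i) = R_{i+2}`, `φ(e_i) = E_{i+2}` for `1 ≤ i ≤ n-1`. -/
def IsPhiHom (n : ℕ) (φ : BrauerB n →ₐ[Lp] BrauerQ (Dgraph n)) : Prop :=
  φ (rb n 0) = genR (Dgraph n) 0 * genR (Dgraph n) 1 ∧
  φ (eb n 0) = genE (Dgraph n) 0 * genE (Dgraph n) 1 ∧
  ∀ i : ℕ, 1 ≤ i → ∀ h : i < n,
    φ (rb n i) = genR (Dgraph n) ⟨i + 1, by omega⟩ ∧
    φ (eb n i) = genE (Dgraph n) ⟨i + 1, by omega⟩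

section ForkWords

/-! Word identities in a monoid. The letters `a`, `b`, `c` stand for the generators `R` at the two
legs and at the branch point of a fork, and `A`, `B`, `C` for the corresponding `E`. -/

variable {M : Type*} [Monoid M] {a b c A B C : M}

theorem fork_word_braid (hab : a * b = b * a) (ha : a * c * a = c * a * c)
    (hb : b * c * b = c * b * c) :
    c * (a * b) * c * (a * b) = a * b * c * (a * b) * c := by
  calc
    c * (a * b) * c * (a * b) = c * a * (b * c * b) * a := by
      nth_rw 2 [hab]; simp only [mul_assoc]
    _ = c * a * c * b * (c * a) := by rw [hb]; simp only [mul_assoc]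
    _ = a * c * (a * b) * c * a := by rw [← ha]; simp only [mul_assoc]
    _ = a * c * b * (a * c * a) := by rw [hab]; simp only [mul_assoc]
    _ = a * (c * b * c) * a * c := by rw [ha]; simp only [mul_assoc]
    _ = a * b * c * (b * a) * c := by rw [← hb]; simp only [mul_assoc]
    _ = a * b * c * (a * b) * c := by rw [hab]

theorem fork_word_absorb_left (hab : a * b = b * a) (haa : a * a = 1) (hAB : A * B = B * A)
    (ha : a * C * A = c * A) (hb : b * C * B = c * B) :
    a * b * c * (A * B) = c * (A * B) := by
  calc
    a * b * c * (A * B) = a * b * (c * A) * B := by simp only [mul_assoc]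
    _ = a * b * a * C * (A * B) := by rw [← ha]; simp only [mul_assoc]
    _ = a * a * (b * C * B) * A := by rw [hAB, mul_assoc a b a, ← hab]; simp only [mul_assoc]
    _ = c * (A * B) := by rw [haa, hb, hAB, one_mul, mul_assoc]

theorem fork_word_absorb_right (haa : a * a = 1) (hAB : A * B = B * A)
    (ha : A * C * a = A * c) (hb : B * C * b = B * c) :
    A * B * c * (a * b) = A * B * c := by
  calc
    A * B * c * (a * b) = B * (A * c) * a * b := by rw [hAB]; simp only [mul_assoc]
    _ = B * A * C * (a * a) * b := by rw [← ha]; simp only [mul_assoc]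
    _ = A * (B * C * b) := by rw [haa, ← hAB]; simp only [mul_assoc, one_mul]
    _ = A * B * c := by rw [hb, mul_assoc]

theorem fork_word_absorb_right' (hbb : b * b = 1) (hAB : A * B = B * A)
    (ha : A * C * a = A * c) (hb : B * C * b = B * c) :
    A * B * C * (a * b) = A * B * C := by
  calc
    A * B * C * (a * b) = B * (A * C * a) * b := by rw [hAB]; simp only [mul_assoc]
    _ = B * A * c * b := by rw [ha]; simp only [mul_assoc]
    _ = A * (B * c) * b := by rw [← hAB]; simp only [mul_assoc]
    _ = A * B * C * (b * b) := by rw [← hb]; simp only [mul_assoc]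
    _ = A * B * C := by rw [hbb, mul_one]

theorem fork_word_commute (hab : a * b = b * a) (haa : a * a = 1) (hbb : b * b = 1)
    (ha : a * c * a = c * a * c) (haB : a * B = B * a) (hb : b * C * b = c * B * c) :
    a * b * c * (a * b) * C = C * (a * b * c * (a * b)) := by
  have hsq : a * b * (a * b) = 1 := by
    nth_rw 2 [hab]; rw [mul_assoc, ← mul_assoc b, hbb, one_mul, haa]
  have hX : a * b * C * (a * b) = a * c * B * c * a := by
    calc
      a * b * C * (a * b) = a * (b * C * b) * a := by
        nth_rw 2 [hab]; simp only [mul_assoc]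
      _ = a * c * B * c * a := by rw [hb]; simp only [mul_assoc]
  have hc : c * (a * b * C * (a * b)) = a * b * C * (a * b) * c := by
    calc
      c * (a * b * C * (a * b)) = c * a * c * B * c * a := by rw [hX]; simp only [mul_assoc]
      _ = a * c * (a * B) * c * a := by rw [← ha]; simp only [mul_assoc]
      _ = a * c * B * (a * c * a) := by rw [haB]; simp only [mul_assoc]
      _ = a * b * C * (a * b) * c := by rw [ha, hX]; simp only [mul_assoc]
  calc
    a * b * c * (a * b) * C = a * b * c * (a * b) * C * (a * b * (a * b)) := by rw [hsq, mul_one]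
    _ = a * b * (c * (a * b * C * (a * b))) * (a * b) := by simp only [mul_assoc]
    _ = a * b * (a * b) * C * (a * b * c * (a * b)) := by rw [hc]; simp only [mul_assoc]
    _ = C * (a * b * c * (a * b)) := by rw [hsq, one_mul]

theorem fork_word_sandwich (hab : a * b = b * a) (hcc : c * c = 1) (hAB : A * B = B * A)
    (ha : a * C * a = c * A * c) (hb : c * B * C = b * C) (hb' : b * c * B = C * B) :
    a * b * C * (a * b) * C = C * (A * B) * C := by
  calc
    a * b * C * (a * b) * C = b * (a * C * a) * (b * C) := by
      nth_rw 1 [hab]; simp only [mul_assoc]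
    _ = b * c * A * (c * c) * B * C := by rw [ha, ← hb]; simp only [mul_assoc]
    _ = b * c * (A * B) * C := by rw [hcc]; simp only [mul_assoc, one_mul]
    _ = b * c * B * A * C := by rw [hAB]; simp only [mul_assoc]
    _ = C * (A * B) * C := by rw [hb', hAB]; simp only [mul_assoc]

theorem fork_word_contract {x : M} (hAB : A * B = B * A) (hB : B * x * B = B) :
    A * B * x * (A * B) = A * A * B := by
  calc
    A * B * x * (A * B) = A * (B * x * B) * A := by
      nth_rw 2 [hAB]; simp only [mul_assoc]
    _ = A * A * B := by rw [hB, mul_assoc, ← hAB, mul_assoc]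

end ForkWords

namespace BrauerQ

variable {V : Type} {G : SimpleGraph V} {i j a b c : V}

theorem genR_mul_self (i : V) : genR G i * genR G i = 1 := by
  simpa [genR] using RingQuot.mkAlgHom_rel Lp (BrauerQRel.RR (G := G) i)

theorem genE_mul_self (i : V) : genE G i * genE G i = δpar • genE G i := by
  simpa [genE] using RingQuot.mkAlgHom_rel Lp (BrauerQRel.EE (G := G) i)

theorem genR_mul_genE (i : V) : genR G i * genE G i = genE G i := by
  simpa [genR, genE] using RingQuot.mkAlgHom_rel Lp (BrauerQRel.RE (G := G) i)

theorem genE_mul_genR (i : V) : genE G i * genR G i = genE G i := by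
  simpa [genR, genE] using RingQuot.mkAlgHom_rel Lp (BrauerQRel.ER (G := G) i)

theorem genR_comm (hne : i ≠ j) (h : ¬ G.Adj i j) : genR G i * genR G j = genR G j * genR G i := by
  simpa [genR] using RingQuot.mkAlgHom_rel Lp (BrauerQRel.RRfar (G := G) i j hne h)

theorem genE_genR_comm (hne : i ≠ j) (h : ¬ G.Adj i j) :
    genE G i * genR G j = genR G j * genE G i := by
  simpa [genR, genE] using RingQuot.mkAlgHom_rel Lp (BrauerQRel.ERfar (G := G) i j hne h)

theorem genE_comm (hne : i ≠ j) (h : ¬ G.Adj i j) : genE G i * genE G j = genE G j * genE G i := by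
  simpa [genE] using RingQuot.mkAlgHom_rel Lp (BrauerQRel.EEfar (G := G) i j hne h)

theorem genR_braid (h : G.Adj i j) :
    genR G i * genR G j * genR G i = genR G j * genR G i * genR G j := by
  simpa [genR] using RingQuot.mkAlgHom_rel Lp (BrauerQRel.braid (G := G) i j h)

theorem genR_genR_genE (h : G.Adj i j) :
    genR G j * genR G i * genE G j = genE G i * genE G j := by
  simpa [genR, genE] using RingQuot.mkAlgHom_rel Lp (BrauerQRel.RRE (G := G) i j h)

theorem genR_genE_genR (h : G.Adj i j) :
    genR G i * genE G j * genR G i = genR G j * genE G i * genR G j := by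
  simpa [genR, genE] using RingQuot.mkAlgHom_rel Lp (BrauerQRel.RER (G := G) i j h)

theorem genR_genE_genE (h : G.Adj i j) :
    genR G i * genE G j * genE G i = genR G j * genE G i := by
  have := genR_genR_genE h.symm
  have := genR_mul_self (G := G) i
  grind

theorem genE_genR_genR (h : G.Adj i j) :
    genE G j * genR G i * genR G j = genE G j * genE G i := by
  calc
    genE G j * genR G i * genR G j = genR G i * (genR G i * genE G j * genR G i) * genR G j := by
      have := genR_mul_self (G := G) i
      grind
    _ = genR G i * genR G j * genE G i := by
      rw [genR_genE_genR h]
      have := genR_mul_self (G := G) j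
      grind
    _ = genE G j * genE G i := genR_genR_genE h.symm

theorem genE_genE_genR (h : G.Adj i j) :
    genE G i * genE G j * genR G i = genE G i * genR G j := by
  have := genE_genR_genR h.symm
  have := genR_mul_self (G := G) i
  grind

theorem genE_genE_genE (h : G.Adj i j) : genE G i * genE G j * genE G i = genE G i := by
  have := genR_genR_genE h
  have := genR_genR_genE h.symm
  have := genR_mul_self (G := G) i
  have := genR_mul_self (G := G) j
  grind

theorem genE_genR_genE (h : G.Adj i j) : genE G i * genR G j * genE G i = genE G i := by
  have := genR_genE_genE h
  have := genE_mul_genR (G := G) i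
  have := genE_genE_genE h
  grind

theorem fork_genR_mul_self (hab : a ≠ b) (nab : ¬ G.Adj a b) :
    genR G a * genR G b * (genR G a * genR G b) = 1 := by
  rw [mul_assoc, ← mul_assoc (genR G b), ← genR_comm hab nab, mul_assoc (genR G a) (genR G b),
    genR_mul_self, mul_one, genR_mul_self]

theorem fork_genR_mul_genE (hab : a ≠ b) (nab : ¬ G.Adj a b) :
    genR G a * genR G b * (genE G a * genE G b) = genE G a * genE G b := by
  rw [mul_assoc, ← mul_assoc (genR G b), ← genE_genR_comm hab nab, mul_assoc (genE G a),
    genR_mul_genE, ← mul_assoc, genR_mul_genE]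

theorem fork_genE_mul_genR (hab : a ≠ b) (nab : ¬ G.Adj a b) :
    genE G a * genE G b * (genR G a * genR G b) = genE G a * genE G b := by
  rw [mul_assoc, ← mul_assoc (genE G b), genE_genR_comm hab.symm (fun h => nab h.symm),
    mul_assoc (genR G a), genE_mul_genR, ← mul_assoc, genE_mul_genR]

theorem fork_genE_mul_self (hab : a ≠ b) (nab : ¬ G.Adj a b) :
    genE G a * genE G b * (genE G a * genE G b) = (δpar * δpar) • (genE G a * genE G b) := by
  rw [mul_assoc, ← mul_assoc (genE G b), ← genE_comm hab nab, mul_assoc (genE G a) (genE G b),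
    ← mul_assoc, genE_mul_self, genE_mul_self, smul_mul_smul_comm]

theorem fork_genE_genR_genE (hab : a ≠ b) (nab : ¬ G.Adj a b) (hbc : G.Adj b c) :
    genE G a * genE G b * genR G c * (genE G a * genE G b) = δpar • (genE G a * genE G b) := by
  rw [fork_word_contract (genE_comm hab nab) (genE_genR_genE hbc), genE_mul_self, smul_mul_assoc]

theorem fork_genE_genE_genE (hab : a ≠ b) (nab : ¬ G.Adj a b) (hbc : G.Adj b c) :
    genE G a * genE G b * genE G c * (genE G a * genE G b) = δpar • (genE G a * genE G b) := by
  rw [fork_word_contract (genE_comm hab nab) (genE_genE_genE hbc), genE_mul_self, smul_mul_assoc]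

theorem fork_genR_genR (hab : a ≠ b) (nab : ¬ G.Adj a b) (hac : G.Adj a c) (hbc : G.Adj b c) :
    genR G c * (genR G a * genR G b) * genR G c * (genR G a * genR G b) =
      genR G a * genR G b * genR G c * (genR G a * genR G b) * genR G c :=
  fork_word_braid (genR_comm hab nab) (genR_braid hac) (genR_braid hbc)

theorem fork_genR_genR_genE (hab : a ≠ b) (nab : ¬ G.Adj a b) (hac : G.Adj a c) (hbc : G.Adj b c) :
    genR G a * genR G b * genR G c * (genE G a * genE G b) = genR G c * (genE G a * genE G b) :=
  fork_word_absorb_left (genR_comm hab nab) (genR_mul_self a) (genE_comm hab nab)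
    (genR_genE_genE hac) (genR_genE_genE hbc)

theorem fork_genR_genE_genR_genE (hab : a ≠ b) (nab : ¬ G.Adj a b) (hac : G.Adj a c)
    (hbc : G.Adj b c) :
    genR G a * genR G b * genE G c * (genR G a * genR G b) * genE G c =
      genE G c * (genE G a * genE G b) * genE G c :=
  fork_word_sandwich (genR_comm hab nab) (genR_mul_self c) (genE_comm hab nab)
    (genR_genE_genR hac) (genR_genE_genE hbc.symm) (genR_genR_genE hbc.symm)

theorem fork_genR_genR_genR_genE (hab : a ≠ b) (nab : ¬ G.Adj a b) (hac : G.Adj a c)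
    (hbc : G.Adj b c) :
    genR G a * genR G b * genR G c * (genR G a * genR G b) * genE G c =
      genE G c * (genR G a * genR G b * genR G c * (genR G a * genR G b)) :=
  fork_word_commute (genR_comm hab nab) (genR_mul_self a) (genR_mul_self b) (genR_braid hac)
    (genE_genR_comm hab.symm fun h => nab h.symm).symm (genR_genE_genR hbc)

theorem fork_genE_genR_genR (hab : a ≠ b) (nab : ¬ G.Adj a b) (hac : G.Adj a c) (hbc : G.Adj b c) :
    genE G a * genE G b * genR G c * (genR G a * genR G b) = genE G a * genE G b * genR G c :=
  fork_word_absorb_right (genR_mul_self a) (genE_comm hab nab)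
    (genE_genE_genR hac) (genE_genE_genR hbc)

theorem fork_genE_genE_genR (hab : a ≠ b) (nab : ¬ G.Adj a b) (hac : G.Adj a c) (hbc : G.Adj b c) :
    genE G a * genE G b * genE G c * (genR G a * genR G b) = genE G a * genE G b * genE G c :=
  fork_word_absorb_right' (genR_mul_self b) (genE_comm hab nab)
    (genE_genE_genR hac) (genE_genE_genR hbc)

end BrauerQ

namespace BrauerB

open BrauerQ

theorem Dgraph_adj_iff {n : ℕ} {i j : Fin (n + 1)} :
    (Dgraph n).Adj i j ↔
      (i.val = 0 ∧ j.val = 2) ∨ (i.val = 1 ∧ j.val = 2) ∨ (2 ≤ i.val ∧ j.val = i.val + 1) ∨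
      (j.val = 0 ∧ i.val = 2) ∨ (j.val = 1 ∧ i.val = 2) ∨ (2 ≤ j.val ∧ i.val = j.val + 1) := by
  rw [Dgraph, SimpleGraph.fromRel_adj, ne_eq, Fin.ext_iff]
  omega

/-- The prescribed values of `φ` on the generators of `Br(B_n)`. -/
noncomputable def phiGen (n : ℕ) : BGen n → BrauerQ (Dgraph n)
  | .r i => if i.val = 0 then genR (Dgraph n) 0 * genR (Dgraph n) 1 else genR (Dgraph n) i.succ
  | .e i => if i.val = 0 then genE (Dgraph n) 0 * genE (Dgraph n) 1 else genE (Dgraph n) i.succ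

theorem lift_phiGen_rel (n : ℕ) ⦃x y : FreeAlgebra Lp (BGen (n + 1))⦄
    (h : BrauerBRel (n + 1) x y) :
    FreeAlgebra.lift Lp (phiGen (n + 1)) x = FreeAlgebra.lift Lp (phiGen (n + 1)) y := by
  have hne : (0 : Fin (n + 2)) ≠ 1 := by simp
  have hna : ¬ (Dgraph (n + 1)).Adj 0 1 := by simp [Dgraph_adj_iff]
  have hadj (i j : Fin (n + 1)) (h : i.val + 1 = j.val ∨ j.val + 1 = i.val) (hi : 0 < i.val)
      (hj : 0 < j.val) : (Dgraph (n + 1)).Adj i.succ j.succ := by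
    simp only [Dgraph_adj_iff, Fin.val_succ]; omega
  have hadj₀ (j : Fin (n + 1)) (h : j.val = 1) : (Dgraph (n + 1)).Adj 0 j.succ := by
    simp [Dgraph_adj_iff, h]
  have hadj₁ (j : Fin (n + 1)) (h : j.val = 1) : (Dgraph (n + 1)).Adj 1 j.succ := by
    simp [Dgraph_adj_iff, h]
  have hfar (i j : Fin (n + 1)) (h : i.val + 2 ≤ j.val ∨ j.val + 2 ≤ i.val) (hi : i.val ≠ 0)
      (hj : j.val ≠ 0) : i.succ ≠ j.succ ∧ ¬ (Dgraph (n + 1)).Adj i.succ j.succ := by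
    simp only [Dgraph_adj_iff, Fin.val_succ, ne_eq, Fin.ext_iff]; omega
  have hfar₀ (j : Fin (n + 1)) (h : 2 ≤ j.val) :
      0 ≠ j.succ ∧ ¬ (Dgraph (n + 1)).Adj 0 j.succ := by
    simp only [Dgraph_adj_iff, Fin.val_succ, Fin.val_zero, ne_eq, Fin.ext_iff]; omega
  have hfar₁ (j : Fin (n + 1)) (h : 2 ≤ j.val) :
      1 ≠ j.succ ∧ ¬ (Dgraph (n + 1)).Adj 1 j.succ := by
    simp only [Dgraph_adj_iff, Fin.val_succ, Fin.val_one, ne_eq, Fin.ext_iff]; omega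
  have cR (i j : Fin (n + 2)) (h : i ≠ j ∧ ¬ (Dgraph (n + 1)).Adj i j) :
      Commute (genR (Dgraph (n + 1)) i) (genR _ j) := genR_comm h.1 h.2
  have cE (i j : Fin (n + 2)) (h : i ≠ j ∧ ¬ (Dgraph (n + 1)).Adj i j) :
      Commute (genE (Dgraph (n + 1)) i) (genE _ j) := genE_comm h.1 h.2
  have cER (i j : Fin (n + 2)) (h : i ≠ j ∧ ¬ (Dgraph (n + 1)).Adj i j) :
      Commute (genE (Dgraph (n + 1)) i) (genR _ j) := genE_genR_comm h.1 h.2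
  have cRE (i j : Fin (n + 2)) (h : i ≠ j ∧ ¬ (Dgraph (n + 1)).Adj i j) :
      Commute (genR (Dgraph (n + 1)) i) (genE _ j) :=
    (genE_genR_comm h.1.symm fun h' => h.2 h'.symm).symm
  induction h with
  | rr i =>
    by_cases hi : i.val = 0 <;>
      simp [fr, phiGen, hi, genR_mul_self, fork_genR_mul_self hne hna]
  | re i =>
    by_cases hi : i.val = 0 <;>
      simp [fr, fe, phiGen, hi, genR_mul_genE, fork_genR_mul_genE hne hna]
  | er i =>
    by_cases hi : i.val = 0 <;>
      simp [fr, fe, phiGen, hi, genE_mul_genR, fork_genE_mul_genR hne hna]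
  | ee i h => simp [fe, phiGen, h.ne', genE_mul_self]
  | e0e0 i h => simp only [fe, map_mul, map_smul, FreeAlgebra.lift_ι_apply, phiGen, h, if_true,
      fork_genE_mul_self hne hna]
  | rrFar i j h =>
    simp only [fr, map_mul, FreeAlgebra.lift_ι_apply, phiGen]
    split_ifs with hi hj hj
    · rfl
    · exact (cR _ _ (hfar₀ j (by omega))).mul_left (cR _ _ (hfar₁ j (by omega)))
    · exact ((cR _ _ (hfar₀ i (by omega))).mul_left (cR _ _ (hfar₁ i (by omega)))).symm
    · exact cR _ _ (hfar i j h hi hj)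
  | erFar i j h =>
    simp only [fr, fe, map_mul, FreeAlgebra.lift_ι_apply, phiGen]
    split_ifs with hi hj hj
    · omega
    · exact (cER _ _ (hfar₀ j (by omega))).mul_left (cER _ _ (hfar₁ j (by omega)))
    · exact ((cRE _ _ (hfar₀ i (by omega))).mul_left (cRE _ _ (hfar₁ i (by omega)))).symm
    · exact cER _ _ (hfar i j h hi hj)
  | eeFar i j h =>
    simp only [fe, map_mul, FreeAlgebra.lift_ι_apply, phiGen]
    split_ifs with hi hj hj
    · rfl
    · exact (cE _ _ (hfar₀ j (by omega))).mul_left (cE _ _ (hfar₁ j (by omega)))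
    · exact ((cE _ _ (hfar₀ i (by omega))).mul_left (cE _ _ (hfar₁ i (by omega)))).symm
    · exact cE _ _ (hfar i j h hi hj)
  | braid i j h hi hj => simp [fr, phiGen, hi.ne', hj.ne', genR_braid (hadj i j h hi hj)]
  | rre i j h hi hj => simp [fr, fe, phiGen, hi.ne', hj.ne', genR_genR_genE (hadj i j h hi hj)]
  | rer i j h hi hj => simp [fr, fe, phiGen, hi.ne', hj.ne', genR_genE_genR (hadj i j h hi hj)]
  | b1010 i j h0 h1 =>
    simpa [fr, phiGen, h0, h1] using fork_genR_genR hne hna (hadj₀ j h1) (hadj₁ j h1)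
  | b_r0r1e0 i j h0 h1 =>
    simpa [fr, fe, phiGen, h0, h1] using fork_genR_genR_genE hne hna (hadj₀ j h1) (hadj₁ j h1)
  | b_r0e1r0e1 i j h0 h1 =>
    simpa [fr, fe, phiGen, h0, h1] using fork_genR_genE_genR_genE hne hna (hadj₀ j h1) (hadj₁ j h1)
  | b_r0r1r0e1 i j h0 h1 =>
    simpa [fr, fe, phiGen, h0, h1] using fork_genR_genR_genR_genE hne hna (hadj₀ j h1) (hadj₁ j h1)
  | b_e0r1e0 i j h0 h1 =>
    simpa [fr, fe, phiGen, h0, h1] using fork_genE_genR_genE hne hna (hadj₁ j h1)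
  | b_e0e1e0 i j h0 h1 =>
    simpa [fr, fe, phiGen, h0, h1] using fork_genE_genE_genE hne hna (hadj₁ j h1)
  | b_e0r1r0 i j h0 h1 =>
    simpa [fr, fe, phiGen, h0, h1] using fork_genE_genR_genR hne hna (hadj₀ j h1) (hadj₁ j h1)
  | b_e0e1r0 i j h0 h1 =>
    simpa [fr, fe, phiGen, h0, h1] using fork_genE_genE_genR hne hna (hadj₀ j h1) (hadj₁ j h1)

theorem isPhiHom_iff {n : ℕ} {φ : BrauerB (n + 1) →ₐ[Lp] BrauerQ (Dgraph (n + 1))} :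
    IsPhiHom (n + 1) φ ↔ ∀ g : BGen (n + 1),
      φ (RingQuot.mkAlgHom Lp (BrauerBRel (n + 1)) (FreeAlgebra.ι Lp g)) = phiGen (n + 1) g := by
  constructor
  · rintro ⟨hr, he, h⟩ (i | i) <;> rcases eq_or_ne i.val 0 with hi | hi
    · obtain rfl : i = 0 := Fin.ext hi
      simpa [rb, fr, phiGen] using hr
    · have hi' : φ (rb (n + 1) i) = genR _ i.succ := (h i (by omega) i.isLt).1
      simpa [rb, fr, phiGen, hi, i.is_le] using hi'
    · obtain rfl : i = 0 := Fin.ext hi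
      simpa [eb, fe, phiGen] using he
    · have hi' : φ (eb (n + 1) i) = genE _ i.succ := (h i (by omega) i.isLt).2
      simpa [eb, fe, phiGen, hi, i.is_le] using hi'
  · intro h
    refine ⟨?_, ?_, fun i hi hin => ⟨?_, ?_⟩⟩
    · simpa [rb, fr, phiGen] using h (.r 0)
    · simpa [eb, fe, phiGen] using h (.e 0)
    · simpa [rb, fr, phiGen, hin, Nat.one_le_iff_ne_zero.mp hi] using h (.r ⟨i, hin⟩)
    · simpa [eb, fe, phiGen, hin, Nat.one_le_iff_ne_zero.mp hi] using h (.e ⟨i, hin⟩)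

theorem phiGen_mem_BrMD {n : ℕ} (g : BGen n) : phiGen n g ∈ BrMD n := by
  have hR (i : Fin (n + 1)) : genR (Dgraph n) i ∈ BrMD n :=
    Submonoid.subset_closure (.inl (.inr ⟨i, rfl⟩))
  have hE (i : Fin (n + 1)) : genE (Dgraph n) i ∈ BrMD n :=
    Submonoid.subset_closure (.inr ⟨i, rfl⟩)
  rcases g with i | i <;> rw [phiGen] <;> split_ifs
  exacts [mul_mem (hR 0) (hR 1), hR _, mul_mem (hE 0) (hE 1), hE _]

theorem map_phiGen {n : ℕ} {σ : BrauerQ (Dgraph (n + 1)) ≃ₐ[Lp] BrauerQ (Dgraph (n + 1))}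
    (hσ : IsDiagramAut (n + 1) σ) (g : BGen (n + 1)) :
    σ (phiGen (n + 1) g) = phiGen (n + 1) g := by
  obtain ⟨hR₀, hR₁, hE₀, hE₁, h⟩ := hσ
  have hne : (0 : Fin (n + 2)) ≠ 1 := by simp
  have hna : ¬ (Dgraph (n + 1)).Adj 0 1 := by simp [Dgraph_adj_iff]
  rcases g with i | i <;> rw [phiGen] <;> split_ifs with hi
  · rw [map_mul, hR₀, hR₁, genR_comm hne hna]
  · exact (h i.succ (by simp only [Fin.val_succ]; omega)).1
  · rw [map_mul, hE₀, hE₁, genE_comm hne hna]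
  · exact (h i.succ (by simp only [Fin.val_succ]; omega)).2

theorem mem_SBrD {n : ℕ} {φ : BrauerB (n + 1) →ₐ[Lp] BrauerQ (Dgraph (n + 1))}
    (hφ : IsPhiHom (n + 1) φ) {σ : BrauerQ (Dgraph (n + 1)) ≃ₐ[Lp] BrauerQ (Dgraph (n + 1))}
    (hσ : IsDiagramAut (n + 1) σ) (x : BrauerB (n + 1)) : φ x ∈ SBrD (n + 1) σ := by
  let S : Submonoid (BrauerQ (Dgraph (n + 1))) :=
    BrMD (n + 1) ⊓ MonoidHom.eqLocusM (σ : _ →* _) (MonoidHom.id _)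
  have hS : SBrD (n + 1) σ =
      Subalgebra.toSubmodule (Algebra.adjoin Lp (S : Set (BrauerQ (Dgraph (n + 1))))) := by
    rw [Algebra.adjoin_eq_span, Submonoid.closure_eq]
    rfl
  rw [hS, Subalgebra.mem_toSubmodule]
  obtain ⟨y, rfl⟩ := RingQuot.mkAlgHom_surjective Lp (BrauerBRel (n + 1)) x
  induction y using FreeAlgebra.induction with
  | grade0 r => simp [algebraMap_mem]
  | grade1 g =>
    rw [isPhiHom_iff.mp hφ]
    exact Algebra.subset_adjoin ⟨phiGen_mem_BrMD g, map_phiGen hσ g⟩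
  | mul a b ha hb => rw [map_mul, map_mul]; exact mul_mem ha hb
  | add a b ha hb => rw [map_add, map_add]; exact add_mem ha hb

end BrauerB

/-- There is a unique `ℤ[δ,δ⁻¹]`-algebra homomorphism `φ : Br(B_n) → Br(D_{n+1})` with
`φ(r₀) = R_1R_2`, `φ(r_i) = R_{i+2}`, `φ(e₀) = E_1E_2`, `φ(e_i) = E_{i+2}`
(for `1 ≤ i ≤ n-1`), and its image is contained in the symmetric subalgebra
`SBr(D_{n+1})`. -/
theorem statement_5 (n : ℕ) (hn : 1 ≤ n) :
    (∃! φ : BrauerB n →ₐ[Lp] BrauerQ (Dgraph n), IsPhiHom n φ) ∧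
    (∀ φ : BrauerB n →ₐ[Lp] BrauerQ (Dgraph n), IsPhiHom n φ →
      ∀ σ : BrauerQ (Dgraph n) ≃ₐ[Lp] BrauerQ (Dgraph n), IsDiagramAut n σ →
        ∀ x : BrauerB n, φ x ∈ SBrD n σ) := by
  obtain ⟨n, rfl⟩ := Nat.exists_eq_add_of_le' hn
  refine ⟨⟨RingQuot.liftAlgHom Lp ⟨_, BrauerB.lift_phiGen_rel n⟩, ?_, fun φ hφ => ?_⟩,
    fun φ hφ σ hσ => BrauerB.mem_SBrD hφ hσ⟩
  · simp [BrauerB.isPhiHom_iff]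
  · refine RingQuot.ringQuot_ext' _ _ _ (FreeAlgebra.hom_ext (funext fun g => ?_))
    simpa using BrauerB.isPhiHom_iff.mp hφ g
end

section
/- For n ≥ 2, the ℤ[δ,δ⁻¹]-subalgebra of Br(B_n) generated by r_1,…,r_{n−1} and e_1,…,e_{n−1} is isomorphic as a ℤ[δ,δ⁻¹]-algebra to the Brauer algebra Br(A_{n−1}), where A_{n−1} is the path graph with vertices 1,…,n−1 and edges {i,i+1} for 1 ≤ i ≤ n−2, via the map sending r_i ↦ R_i and e_i ↦ E_i. -/
/-- The path graph `A_m` on `m` vertices `0, …, m-1` with edges `{i, i+1}`. -/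
def Agraph (m : ℕ) : SimpleGraph (Fin m) :=
  SimpleGraph.fromRel (fun i j => j.val = i.val + 1)

/-- The Coxeter relations of type `A_n` for elements `R 0, …, R (n - 1)` of a monoid. -/
structure CoxeterRelationsA {M : Type*} [Monoid M] (n : ℕ) (R : ℕ → M) : Prop where
  sq : ∀ i, i < n → R i * R i = 1
  braid : ∀ i, i + 1 < n → R i * R (i + 1) * R i = R (i + 1) * R i * R (i + 1)
  far : ∀ i j, i + 2 ≤ j → j < n → R i * R j = R j * R i

/-- The descending product `R (k - 1) * ⋯ * R 0`. -/
def descProd {M : Type*} [Monoid M] (R : ℕ → M) : ℕ → M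
  | 0 => 1
  | k + 1 => R k * descProd R k

namespace CoxeterRelationsA

variable {M : Type*} [Monoid M] {n : ℕ} {R : ℕ → M}

theorem shift (h : CoxeterRelationsA (n + 1) R) : CoxeterRelationsA n (fun i => R (i + 1)) where
  sq i hi := h.sq _ (by omega)
  braid i hi := h.braid _ (by omega)
  far i j hij hj := h.far _ _ (by omega) (by omega)

theorem mul_descProd_of_lt (h : CoxeterRelationsA n R) {i k : ℕ} (hk : k < i) (hi : i < n) :
    R i * descProd R k = descProd R k * R i := by
  induction k with
  | zero => simp [descProd]
  | succ k ih =>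
    rw [descProd, ← mul_assoc, ← h.far k i (by omega) hi, mul_assoc, ih (by omega), mul_assoc]

theorem mul_descProd_succ (h : CoxeterRelationsA n R) {k : ℕ} (hk : k < n) :
    R k * descProd R (k + 1) = descProd R k := by
  rw [descProd, ← mul_assoc, h.sq k hk, one_mul]

theorem mul_descProd_of_gt (h : CoxeterRelationsA n R) {i k : ℕ} (hi : i + 2 ≤ k) (hk : k ≤ n) :
    R i * descProd R k = descProd R k * R (i + 1) := by
  induction k, hi using Nat.le_induction with
  | base =>
    rw [descProd, descProd, ← mul_assoc, ← mul_assoc, h.braid i (by omega), mul_assoc,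
      h.mul_descProd_of_lt (Nat.lt_succ_self i) (by omega)]
    simp only [mul_assoc]
  | succ k hk' ih =>
    rw [descProd, ← mul_assoc, h.far i k hk' (by omega), mul_assoc, ih (by omega), mul_assoc]

open Equiv

/-- The permutation of `Fin n` obtained from a permutation of `Fin (n + 1)` by forgetting the
value at `0`. -/
def tailPerm (π : Perm (Fin (n + 1))) : Perm (Fin n) :=
  (Perm.decomposeFin ((π 0).cycleRange * π)).2

theorem succAbove_tailPerm (π : Perm (Fin (n + 1))) (j : Fin n) :
    (π 0).succAbove (tailPerm π j) = π j.succ := by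
  set τ := (π 0).cycleRange * π with hτ
  have h0 : (Perm.decomposeFin τ).1 = 0 := by
    have := Perm.decomposeFin_symm_apply_zero (Perm.decomposeFin τ).1 (Perm.decomposeFin τ).2
    rw [Prod.mk.eta, Equiv.symm_apply_apply] at this
    rw [← this]
    simp [hτ]
  have h1 := Perm.decomposeFin_symm_apply_succ (Perm.decomposeFin τ).2 (Perm.decomposeFin τ).1 j
  rw [Prod.mk.eta, Equiv.symm_apply_apply, h0, swap_self] at h1
  rw [← Fin.cycleRange_symm_succ, tailPerm, ← hτ]
  rw [Equiv.refl_apply] at h1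
  rw [← h1, Equiv.symm_apply_eq]
  rfl

theorem tailPerm_eq {π : Perm (Fin (n + 1))} {e : Perm (Fin n)}
    (h : ∀ j, π j.succ = (π 0).succAbove (e j)) : tailPerm π = e := by
  ext1 j
  exact Fin.succAbove_right_injective ((succAbove_tailPerm π j).trans (h j))

/-- The adjacent transposition exchanging `i` and `i + 1`. -/
def adjSwap (n i : ℕ) (h : i < n) : Perm (Fin (n + 1)) :=
  swap ⟨i, by omega⟩ ⟨i + 1, by omega⟩

theorem exists_equivariant (h : CoxeterRelationsA n R) :
    ∃ f : Perm (Fin (n + 1)) → M, f 1 = 1 ∧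
      ∀ i (hi : i < n) π, f (adjSwap n i hi * π) = R i * f π := by
  induction n generalizing R with
  | zero => exact ⟨fun _ => 1, rfl, fun i hi => absurd hi (by omega)⟩
  | succ n ih =>
    obtain ⟨f, f1, hf⟩ := ih h.shift
    refine ⟨fun π => descProd R (π 0) * f (tailPerm π), ?_, fun i hi π => ?_⟩
    · have h1 : tailPerm (1 : Perm (Fin (n + 2))) = 1 := tailPerm_eq (by simp)
      simp [h1, f1, descProd]
    obtain ⟨k, hkn, hk⟩ : ∃ k, ∃ hkn : k < n + 2, π 0 = ⟨k, hkn⟩ := ⟨π 0, (π 0).isLt, rfl⟩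
    have tail (e : Perm (Fin (n + 1))) (he : ∀ x, adjSwap (n + 1) i hi (Fin.succAbove ⟨k, hkn⟩ x) =
        (adjSwap (n + 1) i hi ⟨k, hkn⟩).succAbove (e x)) :
        tailPerm (adjSwap (n + 1) i hi * π) = e * tailPerm π := by
      refine tailPerm_eq fun j => ?_
      rw [Perm.mul_apply, Perm.mul_apply, Perm.mul_apply, ← succAbove_tailPerm, hk, he]
    simp only [Perm.mul_apply, hk]
    rcases lt_trichotomy k i with hlt | rfl | hgt
    · obtain ⟨i, rfl⟩ : ∃ i', i = i' + 1 := ⟨i - 1, by omega⟩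
      have hk' : adjSwap (n + 1) (i + 1) hi ⟨k, hkn⟩ = ⟨k, hkn⟩ := by
        apply swap_apply_of_ne_of_ne <;> simp only [ne_eq, Fin.ext_iff] <;> omega
      rw [tail (adjSwap n i (by omega)), hf, hk', ← mul_assoc,
        ← h.mul_descProd_of_lt hlt hi, mul_assoc]
      intro x
      rw [hk']
      simp only [adjSwap, swap_apply_def, Fin.succAbove, Fin.ext_iff, Fin.lt_def]
      grind [Fin.val_castSucc]
    · have hk' : adjSwap (n + 1) k hi ⟨k, hkn⟩ = ⟨k + 1, by omega⟩ := swap_apply_left _ _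
      rw [tail 1, one_mul, hk', ← mul_assoc, descProd]
      intro x
      rw [hk']
      simp only [adjSwap, swap_apply_def, Fin.succAbove, Fin.ext_iff, Fin.lt_def, Perm.one_apply]
      grind [Fin.val_castSucc]
    · rcases Nat.lt_or_ge (i + 1) k with hgt' | hle
      · have hk' : adjSwap (n + 1) i hi ⟨k, hkn⟩ = ⟨k, hkn⟩ := by
          apply swap_apply_of_ne_of_ne <;> simp only [ne_eq, Fin.ext_iff] <;> omega
        rw [tail (adjSwap n i (by omega)), hf, hk', ← mul_assoc,
          ← h.mul_descProd_of_gt hgt' (by omega), mul_assoc]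
        intro x
        rw [hk']
        simp only [adjSwap, swap_apply_def, Fin.succAbove, Fin.ext_iff, Fin.lt_def]
        grind [Fin.val_castSucc]
      · obtain rfl : k = i + 1 := by omega
        have hk' : adjSwap (n + 1) i hi ⟨i + 1, hkn⟩ = ⟨i, by omega⟩ := swap_apply_right _ _
        rw [tail 1, one_mul, hk', ← mul_assoc, h.mul_descProd_succ hi]
        intro x
        rw [hk']
        simp only [adjSwap, swap_apply_def, Fin.succAbove, Fin.ext_iff, Fin.lt_def, Perm.one_apply]
        grind [Fin.val_castSucc]

/-- Induction on a permutation of `Fin (n + 1)` along left multiplication by adjacent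
transpositions. -/
theorem adjSwap_induction {P : Perm (Fin (n + 1)) → Prop} (one : P 1)
    (mul : ∀ i (hi : i < n) π, P π → P (adjSwap n i hi * π)) (π) : P π := by
  have hπ : π ∈ Submonoid.closure (Set.range fun i : Fin n => swap i.castSucc i.succ) := by
    rw [Perm.mclosure_swap_castSucc_succ]; trivial
  induction hπ using Submonoid.closure_induction_left with
  | one => exact one
  | mul_left x hx y _ ih =>
    obtain ⟨i, rfl⟩ := hx
    exact mul i i.isLt y ih

/-- Elements satisfying the Coxeter relations of type `A_n` define a homomorphism from the
symmetric group on `n + 1` letters. -/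
theorem exists_hom (h : CoxeterRelationsA n R) :
    ∃ ψ : Perm (Fin (n + 1)) →* M, ∀ i (hi : i < n), ψ (adjSwap n i hi) = R i := by
  obtain ⟨f, f1, hf⟩ := h.exists_equivariant
  refine ⟨⟨⟨f, f1⟩, fun σ τ => ?_⟩, fun i hi => ?_⟩
  · change f (σ * τ) = f σ * f τ
    induction σ using adjSwap_induction with
    | one => simp [f1]
    | mul i hi π ih => rw [mul_assoc, hf, hf, ih, mul_assoc]
  · simpa [f1] using hf i hi 1

end CoxeterRelationsA

section BrauerMonomials

open Equiv

/-- A homomorphism from the symmetric group on `V` together with elements `E a b`, satisfying the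
relations between permutations and single-arc diagrams in a Brauer algebra on strands `V`. -/
structure BrauerSystem (V : Type*) [DecidableEq V] (A : Type*) [Ring A] [Algebra Lp A] where
  ψ : Perm V →* A
  E : V → V → A
  conj : ∀ σ a b, ψ σ * E a b = E (σ a) (σ b) * ψ σ
  symm : ∀ a b, E a b = E b a
  swap_mul : ∀ a b, a ≠ b → ψ (swap a b) * E a b = E a b
  sq : ∀ a b, a ≠ b → E a b * E a b = δpar • E a b
  comm : ∀ a b c d, a ≠ b → a ≠ c → a ≠ d → b ≠ c → b ≠ d → c ≠ d →
    E a b * E c d = E c d * E a b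
  mul_chain : ∀ a b c, a ≠ b → b ≠ c → a ≠ c → E a b * E b c = ψ (swap a c) * E b c

namespace BrauerSystem

variable {V : Type*} [DecidableEq V] {A : Type*} [Ring A] [Algebra Lp A] (S : BrauerSystem V A)

/-- `S.IsArcProduct μ x` says that `x` is the product of the elements `E a (μ a)` over the
two-cycles `(a (μ a))` of the involution `μ`. -/
inductive IsArcProduct : Perm V → A → Prop
  | one : IsArcProduct 1 1
  | mul {a b : V} {μ : Perm V} {x : A} (hab : a ≠ b) (ha : μ a = a) (hb : μ b = b)
      (h : IsArcProduct μ x) : IsArcProduct (swap a b * μ) (S.E a b * x)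

namespace IsArcProduct

variable {S} {μ : Perm V} {x y : A}

theorem involutive (h : S.IsArcProduct μ x) (a : V) : μ (μ a) = a := by
  induction h generalizing a with
  | one => rfl
  | @mul c d ν y hab ha hb h ih =>
    have h1 := ih a
    simp only [Perm.mul_apply, swap_apply_def]
    grind

theorem exists_eq_mul (h : S.IsArcProduct μ x) {a : V} (ha : μ a ≠ a) :
    ∃ y, S.IsArcProduct (swap a (μ a) * μ) y ∧ x = S.E a (μ a) * y := by
  induction h with
  | one => exact absurd rfl ha
  | @mul c d ν y hcd hc hd h ih =>
    by_cases hac : a = c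
    · subst hac
      refine ⟨y, ?_, ?_⟩ <;> simp [hc, h]
    by_cases had : a = d
    · subst had
      refine ⟨y, ?_, ?_⟩ <;> simp [hd, h, swap_comm a c, S.symm a c]
    have hνc : ν a ≠ c := fun e => hac (ν.injective (e.trans hc.symm))
    have hνd : ν a ≠ d := fun e => had (ν.injective (e.trans hd.symm))
    have hμ : (swap c d * ν) a = ν a := by
      rw [Perm.mul_apply, swap_apply_of_ne_of_ne hνc hνd]
    rw [hμ] at ha ⊢
    obtain ⟨z, hz, rfl⟩ := ih ha
    refine ⟨S.E c d * z, ?_, ?_⟩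
    · have : swap a (ν a) * (swap c d * ν) = swap c d * (swap a (ν a) * ν) := by
        rw [← mul_assoc, ← mul_assoc]
        congr 1
        apply Equiv.ext
        intro t
        simp only [Perm.mul_apply, swap_apply_def]
        grind
      rw [this]
      refine mul hcd ?_ ?_ hz
      · rw [Perm.mul_apply, hc, swap_apply_of_ne_of_ne (Ne.symm hac) hνc.symm]
      · rw [Perm.mul_apply, hd, swap_apply_of_ne_of_ne (Ne.symm had) hνd.symm]
    · rw [← mul_assoc, ← mul_assoc,
        S.comm a (ν a) c d ha.symm hac had hνc hνd hcd]

theorem eq (hx : S.IsArcProduct μ x) (hy : S.IsArcProduct μ y) : x = y := by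
  induction hx generalizing y with
  | one =>
    generalize hμ : (1 : Perm V) = μ at hy
    cases hy with
    | one => rfl
    | @mul a b ν z hab ha hb h =>
      have := congrArg (· a) hμ
      simp only [Perm.one_apply, Perm.mul_apply, ha, swap_apply_left] at this
      exact absurd this hab
  | @mul a b ν z hab ha hb h ih =>
    have hμ : (swap a b * ν) a = b := by rw [Perm.mul_apply, ha, swap_apply_left]
    obtain ⟨w, hw, rfl⟩ := hy.exists_eq_mul (a := a) (by rw [hμ]; exact hab.symm)
    rw [hμ] at hw ⊢
    rw [swap_mul_self_mul] at hw
    rw [ih hw]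

theorem swap_mul_eq (h : S.IsArcProduct μ x) {a : V} (ha : μ a ≠ a) :
    S.ψ (swap a (μ a)) * x = x := by
  obtain ⟨y, -, rfl⟩ := h.exists_eq_mul ha
  rw [← mul_assoc, S.swap_mul _ _ ha.symm]

theorem double_swap_mul_eq (h : S.IsArcProduct μ x) {a c : V} (ha : μ a ≠ a) (hc : μ c ≠ c)
    (hac : a ≠ c) (hac' : μ a ≠ c) :
    S.ψ (swap a c * swap (μ a) (μ c)) * x = x := by
  have hinv := h.involutive
  obtain ⟨y, hy, rfl⟩ := h.exists_eq_mul ha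
  have hμμ : μ c ≠ a := fun e => hac' (by rw [← e, hinv])
  have hμac : μ a ≠ μ c := μ.injective.ne hac
  have hc' : (swap a (μ a) * μ) c = μ c := by
    rw [Perm.mul_apply, swap_apply_of_ne_of_ne hμμ hμac.symm]
  obtain ⟨z, -, rfl⟩ := hy.exists_eq_mul (a := c) (by rwa [hc'])
  rw [hc']
  have h1 : S.E (μ a) c * S.E c (μ c) = S.ψ (swap (μ a) (μ c)) * S.E c (μ c) :=
    S.mul_chain _ _ _ hac' hc.symm hμac
  have h2 : S.E (μ a) c * S.E a (μ a) = S.ψ (swap a c) * S.E a (μ a) := by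
    rw [S.symm _ c, S.symm a, S.mul_chain c (μ a) a hac'.symm ha hac.symm, swap_comm]
  have h3 : S.ψ (swap a c) * S.E a (μ a) * S.E c (μ c) =
      S.ψ (swap (μ a) (μ c)) * S.E a (μ a) * S.E c (μ c) := by
    have hcomm := S.comm a (μ a) c (μ c) ha.symm hac hμμ.symm hac' hμac hc.symm
    rw [← h2, mul_assoc, hcomm, ← mul_assoc, h1, mul_assoc, ← hcomm, mul_assoc]
  have h4 : S.ψ (swap a c) * (S.ψ (swap a c) * S.E a (μ a) * S.E c (μ c)) =
      S.E a (μ a) * S.E c (μ c) := by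
    rw [← mul_assoc, ← mul_assoc, ← map_mul, swap_mul_self, map_one, one_mul]
  rw [map_mul]
  rw [h3] at h4
  simpa only [mul_assoc] using congrArg (· * z) h4

/-- Permutations of the arcs of a matching are absorbed by the corresponding arc product. -/
theorem absorb [Fintype V] (h : S.IsArcProduct μ x) {τ : Perm V}
    (hτμ : ∀ a, τ (μ a) = μ (τ a)) (hτ : ∀ a, μ a = a → τ a = a) : S.ψ τ * x = x := by
  induction hn : τ.support.card using Nat.strong_induction_on generalizing τ with
  | _ n ih =>
  by_cases h1 : τ = 1
  · rw [h1, map_one, one_mul]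
  obtain ⟨a, haτ⟩ : ∃ a, τ a ≠ a := by
    by_contra! hall
    exact h1 (Equiv.ext hall)
  have ha : μ a ≠ a := fun e => haτ (hτ a e)
  have hinv := h.involutive
  have reduce (ρ : Perm V) (hρx : S.ψ ρ * x = x) (hρμ : ∀ b, ρ (μ b) = μ (ρ b))
      (hρ : ∀ b, μ b = b → ρ b = b) (hρa : ρ (τ a) = a) (hfix : ∀ b, τ b = b → ρ b = b) :
      S.ψ τ * x = x := by
    have key : S.ψ (ρ * τ) * x = x := by
      refine ih _ ?_ (fun b => ?_) (fun b hb => ?_) rfl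
      · rw [← hn]
        refine Finset.card_lt_card (Finset.ssubset_iff_subset_ne.2 ⟨fun b hb => ?_, fun e => ?_⟩)
        · rw [Perm.mem_support] at hb ⊢
          exact fun hτb => hb (by rw [Perm.mul_apply, hτb, hfix b hτb])
        · have : a ∈ (ρ * τ).support := e ▸ Perm.mem_support.2 haτ
          exact Perm.mem_support.1 this hρa
      · rw [Perm.mul_apply, Perm.mul_apply, hτμ, hρμ]
      · rw [Perm.mul_apply, hτ b hb, hρ b hb]
    have hinj : S.ψ ρ⁻¹ * (S.ψ ρ * (S.ψ τ * x)) = S.ψ ρ⁻¹ * (S.ψ ρ * x) := by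
      rw [← mul_assoc (S.ψ ρ), ← map_mul, key, hρx]
    simpa only [← mul_assoc, ← map_mul, inv_mul_cancel, map_one, one_mul] using hinj
  have hcτ : μ (τ a) ≠ τ a := by rw [← hτμ]; exact τ.injective.ne ha
  have hττ : ∀ b, τ b = b → b ≠ τ a := fun b hb e => haτ (τ.injective (e ▸ hb))
  by_cases hc : μ a = τ a
  · refine reduce (swap a (μ a)) (h.swap_mul_eq ha) (fun b => ?_) (fun b hb => ?_) ?_
      (fun b hb => ?_)
    · have := hinv b
      have := hinv a
      simp only [swap_apply_def]
      grind
    · simp only [swap_apply_def]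
      grind
    · rw [← hc, swap_apply_right]
    · have := hττ b hb
      simp only [swap_apply_def]
      grind
  · refine reduce (swap a (τ a) * swap (μ a) (μ (τ a)))
      (h.double_swap_mul_eq ha hcτ (Ne.symm haτ) hc) (fun b => ?_) (fun b hb => ?_) ?_
      (fun b hb => ?_)
    · have := hinv b
      have := hinv a
      have := hinv (τ a)
      simp only [swap_apply_def, Perm.mul_apply]
      grind
    · have := hinv (τ a)
      simp only [swap_apply_def, Perm.mul_apply]
      grind
    · have := hinv (τ a)
      simp only [swap_apply_def, Perm.mul_apply]
      grind
    · have h2 := hττ b hb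
      have h3 : b ≠ μ a := fun e => haτ (μ.injective (by rw [← hτμ, ← e, hb]))
      have h4 : b ≠ μ (τ a) := fun e => h3 (τ.injective (by rw [hb, hτμ, e]))
      have h5 : b ≠ a := fun e => haτ (e ▸ hb)
      simp only [Perm.mul_apply, swap_apply_of_ne_of_ne h3 h4, swap_apply_of_ne_of_ne h5 h2]

end IsArcProduct

/-- The monomials `ψ σ * x` with `x` an arc product. -/
def monomials : Set A := {u | ∃ σ μ x, S.IsArcProduct μ x ∧ u = S.ψ σ * x}

theorem one_mem_monomials : (1 : A) ∈ S.monomials := ⟨1, 1, 1, .one, by simp⟩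

theorem ψ_mul_mem_monomials (τ : Perm V) {u : A} (hu : u ∈ S.monomials) :
    S.ψ τ * u ∈ S.monomials := by
  obtain ⟨σ, μ, x, h, rfl⟩ := hu
  exact ⟨τ * σ, μ, x, h, by rw [map_mul, mul_assoc]⟩

theorem E_mul_arcProduct_mem_span {μ : Perm V} {x : A} (h : S.IsArcProduct μ x) {a b : V}
    (hab : a ≠ b) : S.E a b * x ∈ Submodule.span Lp S.monomials := by
  have moved (a b : V) (hab : a ≠ b) (ha : μ a ≠ a) :
      S.E a b * x ∈ Submodule.span Lp S.monomials := by
    by_cases hb : μ a = b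
    · obtain ⟨y, -, hy⟩ := h.exists_eq_mul ha
      have : S.E a b * x = δpar • x := by
        rw [hy, hb, ← mul_assoc, S.sq a b hab, smul_mul_assoc]
      rw [this]
      exact Submodule.smul_mem _ _ (Submodule.subset_span ⟨1, μ, x, h, by simp⟩)
    · obtain ⟨y, -, hy⟩ := h.exists_eq_mul ha
      have : S.E a b * x = S.ψ (swap b (μ a)) * x := by
        rw [hy, ← mul_assoc, S.symm a b, S.mul_chain b a (μ a) hab.symm ha.symm (Ne.symm hb),
          mul_assoc]
      rw [this]
      exact Submodule.subset_span ⟨_, μ, x, h, rfl⟩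
  by_cases ha : μ a = a
  · by_cases hb : μ b = b
    · exact Submodule.subset_span ⟨1, _, _, .mul hab ha hb h, by simp⟩
    · rw [S.symm]
      exact moved b a hab.symm hb
  · exact moved a b hab ha

/-- The generators of the subalgebra attached to a Brauer system. -/
def generators : Set A := Set.range S.ψ ∪ {u | ∃ a b, a ≠ b ∧ u = S.E a b}

theorem span_monomials_eq_top (hgen : Algebra.adjoin Lp S.generators = ⊤) :
    Submodule.span Lp S.monomials = ⊤ := by
  have stable (u : A) : ∀ v ∈ Submodule.span Lp S.monomials,
      u * v ∈ Submodule.span Lp S.monomials := by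
    have hu : u ∈ Algebra.adjoin Lp S.generators := hgen ▸ Algebra.mem_top
    induction hu using Algebra.adjoin_induction with
    | mem u hu =>
      intro v hv
      induction hv using Submodule.span_induction with
      | mem v hv =>
        rcases hu with ⟨τ, rfl⟩ | ⟨a, b, hab, rfl⟩
        · exact Submodule.subset_span (S.ψ_mul_mem_monomials τ hv)
        · obtain ⟨σ, μ, x, h, rfl⟩ := hv
          have hconj : S.E a b * (S.ψ σ * x) = S.ψ σ * (S.E (σ⁻¹ a) (σ⁻¹ b) * x) := by
            simp [← mul_assoc, S.conj]
          have hmem := S.E_mul_arcProduct_mem_span h (σ⁻¹.injective.ne hab)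
          rw [hconj]
          have hmap := Submodule.mem_map_of_mem (f := LinearMap.mulLeft Lp (S.ψ σ)) hmem
          rw [Submodule.map_span] at hmap
          refine Submodule.span_mono ?_ hmap
          rintro _ ⟨v, hv, rfl⟩
          exact S.ψ_mul_mem_monomials σ hv
      | zero => simp
      | add v w _ _ hv hw => rw [mul_add]; exact add_mem hv hw
      | smul c v _ hv => rw [mul_smul_comm]; exact Submodule.smul_mem _ _ hv
    | algebraMap c =>
      intro v hv
      rw [← Algebra.smul_def]
      exact Submodule.smul_mem _ _ hv
    | add u u' _ _ h h' => intro v hv; rw [add_mul]; exact add_mem (h v hv) (h' v hv)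
    | mul u u' _ _ h h' => intro v hv; rw [mul_assoc]; exact h _ (h' v hv)
  refine Submodule.eq_top_iff'.2 fun u => ?_
  simpa using stable u 1 (Submodule.subset_span S.one_mem_monomials)

end BrauerSystem

/-- Perfect matchings of the points of `T`, as fixed-point-free involutions. -/
abbrev PerfectMatching (T : Type*) : Type _ := {f : Perm T // (∀ t, f (f t) = t) ∧ ∀ t, f t ≠ t}

namespace PerfectMatching

variable {T : Type*}

/-- Relabelling the points of a perfect matching. -/
def relabel (g : Perm T) (f : PerfectMatching T) : PerfectMatching T :=
  ⟨g * f.1 * g⁻¹, fun t => by simp [f.2.1], fun t h => f.2.2 (g⁻¹ t) (by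
    rw [Perm.mul_apply, Perm.mul_apply] at h
    rw [Perm.eq_inv_iff_eq, h])⟩

theorem relabel_apply (g : Perm T) (f : PerfectMatching T) (t : T) :
    (relabel g f).1 t = g (f.1 (g⁻¹ t)) := rfl

theorem relabel_apply_apply (g : Perm T) (f : PerfectMatching T) (t : T) :
    (relabel g f).1 (g t) = g (f.1 t) := by simp [relabel_apply]

theorem relabel_one (f : PerfectMatching T) : relabel 1 f = f := Subtype.ext (by simp [relabel])

theorem relabel_mul (g h : Perm T) (f : PerfectMatching T) :
    relabel (g * h) f = relabel g (relabel h f) :=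
  Subtype.ext (by simp [relabel, mul_assoc])

theorem ext {f f' : PerfectMatching T} (h : ∀ t, f.1 t = f'.1 t) : f = f' :=
  Subtype.ext (Equiv.ext h)

theorem apply_eq_iff (f : PerfectMatching T) (a b : T) : f.1 a = b ↔ f.1 b = a := by
  constructor <;> rintro rfl <;> exact f.2.1 _

/-- The operator relabelling points by `g`. -/
noncomputable def relabelOp (g : Perm T) : Module.End Lp (PerfectMatching T →₀ Lp) :=
  Finsupp.lmapDomain Lp Lp (relabel g)

theorem relabelOp_single (g : Perm T) (f : PerfectMatching T) (c : Lp) :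
    relabelOp g (Finsupp.single f c) = Finsupp.single (relabel g f) c := by
  simp [relabelOp]

variable [DecidableEq T]

/-- Replace the edges at `a` and `b` by an edge joining `a` and `b` and an edge joining their
former partners. -/
def join (a b : T) (f : PerfectMatching T) : PerfectMatching T := relabel (swap (f.1 a) b) f

theorem relabel_swap_apply (a b : T) (f : PerfectMatching T) (t : T) :
    (relabel (swap a b) f).1 t = swap a b (f.1 (swap a b t)) := by
  rw [relabel_apply, swap_inv]

theorem join_apply (a b : T) (f : PerfectMatching T) (t : T) :
    (join a b f).1 t = swap (f.1 a) b (f.1 (swap (f.1 a) b t)) := relabel_swap_apply _ _ _ _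

theorem relabel_join (g : Perm T) (a b : T) (f : PerfectMatching T) :
    relabel g (join a b f) = join (g a) (g b) (relabel g f) := by
  rw [join, join, ← relabel_mul, ← relabel_mul, relabel_apply_apply]
  congr 1
  rw [mul_swap_eq_swap_mul]

theorem join_apply_left {a b : T} (hab : a ≠ b) (f : PerfectMatching T) :
    (join a b f).1 a = b := by
  rw [join_apply, swap_apply_of_ne_of_ne (f.2.2 a).symm hab, swap_apply_left]

theorem join_eq_self {a b : T} {f : PerfectMatching T} (h : f.1 a = b) : join a b f = f := by
  rw [join, h, swap_self]
  exact relabel_one f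

theorem join_apply_eq_ite {a b : T} (hab : a ≠ b) (f : PerfectMatching T) (t : T) :
    (join a b f).1 t = if t = a then b else if t = b then a else
      if t = f.1 a then f.1 b else if t = f.1 b then f.1 a else f.1 t := by
  have h1 := f.2.1 a
  have h2 := f.2.1 b
  have h3 := f.2.1 t
  have h4 := f.2.2 a
  simp only [join_apply, swap_apply_def]
  grind

theorem join_comm (a b : T) (f : PerfectMatching T) : join a b f = join b a f := by
  refine ext fun t => ?_
  have h1 := f.2.1 a
  have h2 := f.2.1 b
  have h3 := f.2.1 t
  have h4 := f.2.2 a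
  have h5 := f.2.2 b
  simp only [join_apply, swap_apply_def]
  grind

theorem relabel_swap_eq_self {a b : T} {f : PerfectMatching T} (h : f.1 a = b) :
    relabel (swap a b) f = f := by
  refine ext fun t => ?_
  have h1 := f.2.1 a
  have h3 := f.2.1 t
  simp only [relabel_swap_apply, swap_apply_def]
  grind

theorem join_join_comm {a b c d : T} (hab : a ≠ b) (hac : a ≠ c) (had : a ≠ d) (hbc : b ≠ c)
    (hbd : b ≠ d) (hcd : c ≠ d) (f : PerfectMatching T) :
    join a b (join c d f) = join c d (join a b f) := by
  refine ext fun t => ?_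
  rw [join_apply_eq_ite hab (join c d f), join_apply_eq_ite hcd (join a b f)]
  have key (F G H : T → T) (h1 : F (F a) = a) (h2 : F (F b) = b) (h3 : F (F c) = c)
      (h4 : F (F d) = d) (hne : ∀ t, F t ≠ t)
      (hG : ∀ t, G t = if t = c then d else if t = d then c else
        if t = F c then F d else if t = F d then F c else F t)
      (hH : ∀ t, H t = if t = a then b else if t = b then a else
        if t = F a then F b else if t = F b then F a else F t) :
      (if t = a then b else if t = b then a else
        if t = G a then G b else if t = G b then G a else G t) =
      if t = c then d else if t = d then c else
        if t = H c then H d else if t = H d then H c else H t := by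
    have ha := hG a
    have hb := hG b
    have hc := hH c
    have hd := hH d
    rw [hG t, hH t]
    clear hG hH f
    rw [if_neg hac, if_neg had] at ha
    rw [if_neg hbc, if_neg hbd] at hb
    rw [if_neg hac.symm, if_neg hbc.symm] at hc
    rw [if_neg had.symm, if_neg hbd.symm] at hd
    have hnec := hne c
    have hned := hne d
    have hnea := hne a
    have hneb := hne b
    clear hne
    grind (splits := 30)
  exact key f.1 _ _ (f.2.1 a) (f.2.1 b) (f.2.1 c) (f.2.1 d) f.2.2
    (join_apply_eq_ite hcd f) (join_apply_eq_ite hab f)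

theorem join_apply_eq_iff {a b c d : T} (hac : a ≠ c) (had : a ≠ d) (hbc : b ≠ c)
    (hbd : b ≠ d) (hcd : c ≠ d) (f : PerfectMatching T) :
    (join c d f).1 a = b ↔ f.1 a = b ∨ (f.1 a = c ∧ f.1 d = b) ∨ (f.1 a = d ∧ f.1 c = b) := by
  have h1 := f.2.1 a
  have h2 := f.2.1 b
  have h3 := f.2.1 c
  have h4 := f.2.1 d
  simp only [join_apply, swap_apply_def]
  grind

/-- The scalar contributed by closing up an arc. -/
noncomputable def loopFactor (a b : T) (f : PerfectMatching T) : Lp :=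
  if f.1 a = b then δpar else 1

theorem loopFactor_comm (a b : T) (f : PerfectMatching T) :
    loopFactor a b f = loopFactor b a f := by
  simp only [loopFactor, apply_eq_iff f a b]

theorem loopFactor_mul_comm {a b c d : T} (hac : a ≠ c) (had : a ≠ d) (hbc : b ≠ c)
    (hbd : b ≠ d) (hab : a ≠ b) (hcd : c ≠ d) (f : PerfectMatching T) :
    loopFactor c d f * loopFactor a b (join c d f) =
      loopFactor a b f * loopFactor c d (join a b f) := by
  have h1 := apply_eq_iff f
  simp only [loopFactor, join_apply_eq_iff hac had hbc hbd hcd,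
    join_apply_eq_iff hac.symm hbc.symm had.symm hbd.symm hab]
  grind

/-- The operator applying the arc diagram between `a` and `b`. -/
noncomputable def joinOp (a b : T) : Module.End Lp (PerfectMatching T →₀ Lp) :=
  Finsupp.lsum Lp fun f => loopFactor a b f • Finsupp.lsingle (join a b f)

theorem joinOp_single (a b : T) (f : PerfectMatching T) (c : Lp) :
    joinOp a b (Finsupp.single f c) = Finsupp.single (join a b f) (loopFactor a b f * c) := by
  simp [joinOp]

/-- The Brauer system of operators on formal combinations of perfect matchings of `T`. -/
noncomputable def brauerSystem (T : Type*) [DecidableEq T] :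
    BrauerSystem T (Module.End Lp (PerfectMatching T →₀ Lp)) where
  ψ :=
    { toFun := relabelOp
      map_one' := Finsupp.lhom_ext fun f c => by simp [relabelOp_single, relabel_one]
      map_mul' := fun g h => Finsupp.lhom_ext fun f c => by
        simp [relabelOp_single, relabel_mul] }
  E := joinOp
  conj g a b := Finsupp.lhom_ext fun f c => by
    simp [relabelOp_single, joinOp_single, relabel_join, loopFactor, relabel_apply_apply]
  symm a b := Finsupp.lhom_ext fun f c => by
    simp [joinOp_single, join_comm a b, loopFactor_comm a b]
  swap_mul a b hab := Finsupp.lhom_ext fun f c => by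
    change relabelOp _ (joinOp a b _) = joinOp a b _
    rw [joinOp_single, relabelOp_single, relabel_swap_eq_self (join_apply_left hab f)]
  sq a b hab := Finsupp.lhom_ext fun f c => by
    have h := join_apply_left hab f
    change joinOp a b (joinOp a b _) = δpar • joinOp a b _
    rw [joinOp_single, joinOp_single, join_eq_self h, Finsupp.smul_single, smul_eq_mul,
      loopFactor, if_pos h]
  comm a b c d hab hac had hbc hbd hcd := Finsupp.lhom_ext fun f x => by
    change joinOp a b (joinOp c d _) = joinOp c d (joinOp a b _)
    rw [joinOp_single, joinOp_single, joinOp_single, joinOp_single,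
      join_join_comm hab hac had hbc hbd hcd, ← mul_assoc, ← mul_assoc,
      mul_comm (loopFactor a b _), loopFactor_mul_comm hac had hbc hbd hab hcd,
      mul_comm (loopFactor a b _)]
  mul_chain a b c hab hbc hac := Finsupp.lhom_ext fun f x => by
    have h := join_apply_left hbc f
    have h' : join a b (join b c f) = relabel (swap a c) (join b c f) := by
      rw [join_comm, join, h, swap_comm]
    change joinOp a b (joinOp b c _) = relabelOp _ (joinOp b c _)
    rw [joinOp_single, joinOp_single, relabelOp_single, h', loopFactor_comm a b,
      loopFactor, h, if_neg hac.symm, one_mul]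

end PerfectMatching

namespace BrauerSystem

open PerfectMatching

variable {V T : Type*} [DecidableEq V] [DecidableEq T] {A : Type*} [Ring A] [Algebra Lp A]
  {S : BrauerSystem V A}

/-- An action of a Brauer system on perfect matchings of `T`, where the strand `a` acts on the
point `ι a` and the points `κ a` are not moved. -/
structure MatchingAction (S : BrauerSystem V A) (T : Type*) [DecidableEq T] where
  Φ : A →ₐ[Lp] Module.End Lp (PerfectMatching T →₀ Lp)
  g : Perm V →* Perm T
  ι : V → T
  κ : V → T
  ι_injective : Function.Injective ι
  κ_injective : Function.Injective κ
  ι_ne_κ : ∀ a b, ι a ≠ κ b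
  g_ι : ∀ σ a, g σ (ι a) = ι (σ a)
  g_κ : ∀ σ a, g σ (κ a) = κ a
  map_ψ : ∀ σ, Φ (S.ψ σ) = relabelOp (g σ)
  map_E : ∀ a b, a ≠ b → Φ (S.E a b) = joinOp (ι a) (ι b)
  base : PerfectMatching T
  base_ι : ∀ a, base.1 (ι a) = κ a

namespace MatchingAction

variable (Θ : S.MatchingAction T)

theorem exists_apply_arcProduct {μ : Perm V} {x : A} (h : S.IsArcProduct μ x) :
    ∃ f : PerfectMatching T, Θ.Φ x (Finsupp.single Θ.base 1) = Finsupp.single f 1 ∧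
      ∀ a, (μ a = a → f.1 (Θ.ι a) = Θ.κ a) ∧
        (μ a ≠ a → f.1 (Θ.ι a) = Θ.ι (μ a) ∧ f.1 (Θ.κ a) = Θ.κ (μ a)) := by
  induction h with
  | one => exact ⟨Θ.base, by simp, fun a => ⟨fun _ => Θ.base_ι a, fun h => absurd rfl h⟩⟩
  | @mul a b μ x hab ha hb h ih =>
    obtain ⟨f, hf, H⟩ := ih
    have fa := (H a).1 ha
    have fb := (H b).1 hb
    have hι : Θ.ι a ≠ Θ.ι b := Θ.ι_injective.ne hab
    refine ⟨join (Θ.ι a) (Θ.ι b) f, ?_, fun c => ?_⟩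
    · rw [map_mul, Module.End.mul_apply, hf, Θ.map_E a b hab, joinOp_single, loopFactor, fa,
        if_neg (Θ.ι_ne_κ b a).symm, one_mul]
    have hμ (d : V) : d ≠ a → d ≠ b → (swap a b * μ) d = μ d := fun hda hdb => by
      rw [Perm.mul_apply, swap_apply_of_ne_of_ne]
      · exact fun e => hda (μ.injective (e.trans ha.symm))
      · exact fun e => hdb (μ.injective (e.trans hb.symm))
    have hjoin := join_apply_eq_ite hι f
    rw [fa, fb] at hjoin
    have hκa := f.2.1 (Θ.ι a)
    have hκb := f.2.1 (Θ.ι b)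
    rw [fa] at hκa
    rw [fb] at hκb
    by_cases hca : c = a
    · subst hca
      simp [ha, hab.symm, hjoin, (Θ.ι_ne_κ _ _).symm]
    by_cases hcb : c = b
    · subst hcb
      simp [hb, hab, hjoin, (Θ.ι_ne_κ _ _).symm, Θ.ι_injective.eq_iff, Θ.κ_injective.eq_iff,
        hab.symm]
    rw [hμ c hca hcb, hjoin, hjoin]
    simpa [Θ.ι_ne_κ, (Θ.ι_ne_κ _ _).symm, Θ.ι_injective.eq_iff, Θ.κ_injective.eq_iff, hca, hcb]
      using H c

theorem monomial_ext [Fintype V] {s s' : A} (hs : s ∈ S.monomials) (hs' : s' ∈ S.monomials)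
    (h : Θ.Φ s (Finsupp.single Θ.base 1) = Θ.Φ s' (Finsupp.single Θ.base 1)) : s = s' := by
  obtain ⟨σ, μ, x, hx, rfl⟩ := hs
  obtain ⟨σ', μ', x', hx', rfl⟩ := hs'
  obtain ⟨f, hf, H⟩ := Θ.exists_apply_arcProduct hx
  obtain ⟨f', hf', H'⟩ := Θ.exists_apply_arcProduct hx'
  rw [map_mul, map_mul, Module.End.mul_apply, Module.End.mul_apply, hf, hf', Θ.map_ψ, Θ.map_ψ,
    relabelOp_single, relabelOp_single] at h
  have hF := Finsupp.single_left_injective (one_ne_zero (α := Lp)) h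
  have eκ (a : V) : Θ.g σ (f.1 (Θ.κ a)) = Θ.g σ' (f'.1 (Θ.κ a)) := by
    rw [← relabel_apply_apply, ← relabel_apply_apply, Θ.g_κ, Θ.g_κ, hF]
  have fκ {f : PerfectMatching T} {a : V} (e : f.1 (Θ.ι a) = Θ.κ a) : f.1 (Θ.κ a) = Θ.ι a := by
    rw [← e, f.2.1]
  have key (a : V) : μ a = μ' a ∧ (μ a = a → σ a = σ' a) := by
    have e := eκ a
    by_cases h1 : μ a = a <;> by_cases h2 : μ' a = a
    · rw [fκ ((H a).1 h1), fκ ((H' a).1 h2), Θ.g_ι, Θ.g_ι] at e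
      exact ⟨h1.trans h2.symm, fun _ => Θ.ι_injective e⟩
    · rw [fκ ((H a).1 h1), ((H' a).2 h2).2, Θ.g_ι, Θ.g_κ] at e
      exact absurd e (Θ.ι_ne_κ _ _)
    · rw [((H a).2 h1).2, fκ ((H' a).1 h2), Θ.g_ι, Θ.g_κ] at e
      exact absurd e.symm (Θ.ι_ne_κ _ _)
    · rw [((H a).2 h1).2, ((H' a).2 h2).2, Θ.g_κ, Θ.g_κ] at e
      exact ⟨Θ.κ_injective e, fun h => absurd h h1⟩
  obtain rfl : μ = μ' := Equiv.ext fun a => (key a).1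
  obtain rfl : x = x' := hx.eq hx'
  have hfix (a : V) (ha : μ a = a) : (σ⁻¹ * σ') a = a := by
    rw [Perm.mul_apply, Perm.inv_eq_iff_eq, (key a).2 ha]
  have hcomm (b : V) : (σ⁻¹ * σ') (μ b) = μ ((σ⁻¹ * σ') b) := by
    by_cases hb : μ b = b
    · rw [hb, hfix b hb, hb]
    have ha : μ ((σ⁻¹ * σ') b) ≠ (σ⁻¹ * σ') b := fun e =>
      hb (by rwa [(σ⁻¹ * σ').injective (hfix _ e)] at e)
    have e : (relabel (Θ.g σ) f).1 (Θ.ι (σ' b)) = (relabel (Θ.g σ') f').1 (Θ.ι (σ' b)) := by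
      rw [hF]
    have hb' : Θ.ι (σ' b) = Θ.g σ (Θ.ι ((σ⁻¹ * σ') b)) := by
      simp [Θ.g_ι]
    conv_lhs at e => rw [hb']
    rw [← Θ.g_ι σ', relabel_apply_apply, relabel_apply_apply, ((H _).2 ha).1, ((H' _).2 hb).1,
      Θ.g_ι, Θ.g_ι] at e
    rw [Perm.mul_apply, Perm.inv_eq_iff_eq, Θ.ι_injective e]
  have habs := hx.absorb hcomm hfix
  rw [← mul_inv_cancel_left σ σ', map_mul, mul_assoc, habs]

theorem injective [Fintype V] (hgen : Algebra.adjoin Lp S.generators = ⊤) :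
    Function.Injective Θ.Φ := by
  classical
  let w (f : PerfectMatching T) : A :=
    if h : ∃ s ∈ S.monomials, Θ.Φ s (Finsupp.single Θ.base 1) = Finsupp.single f 1 then h.choose
    else 0
  have hw (s : A) (hs : s ∈ S.monomials) :
      Finsupp.linearCombination Lp w (Θ.Φ s (Finsupp.single Θ.base 1)) = s := by
    obtain ⟨f, hf⟩ : ∃ f, Θ.Φ s (Finsupp.single Θ.base 1) = Finsupp.single f 1 := by
      obtain ⟨σ, μ, x, hx, rfl⟩ := hs
      obtain ⟨f, hf, -⟩ := Θ.exists_apply_arcProduct hx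
      exact ⟨relabel (Θ.g σ) f, by
        rw [map_mul, Module.End.mul_apply, hf, Θ.map_ψ, relabelOp_single]⟩
    have h : ∃ s ∈ S.monomials, Θ.Φ s (Finsupp.single Θ.base 1) = Finsupp.single f 1 :=
      ⟨s, hs, hf⟩
    rw [hf, Finsupp.linearCombination_single, one_smul]
    simp only [w, dif_pos h]
    exact Θ.monomial_ext h.choose_spec.1 hs (h.choose_spec.2.trans hf.symm)
  have hall (u : A) : Finsupp.linearCombination Lp w (Θ.Φ u (Finsupp.single Θ.base 1)) = u := by
    have hu : u ∈ Submodule.span Lp S.monomials :=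
      S.span_monomials_eq_top hgen ▸ Submodule.mem_top
    induction hu using Submodule.span_induction with
    | mem s hs => exact hw s hs
    | zero => simp
    | add u v _ _ hu hv => rw [map_add, LinearMap.add_apply, map_add, hu, hv]
    | smul c u _ hu => rw [map_smul, LinearMap.smul_apply, map_smul, hu]
  exact fun u v h => by rw [← hall u, h, hall v]

end MatchingAction

end BrauerSystem

theorem exists_perm_apply_eq_and_apply_eq {V : Type*} {p q a b : V} (hpq : p ≠ q) (hab : a ≠ b) :
    ∃ σ : Perm V, σ p = a ∧ σ q = b := by
  obtain ⟨σ, hσ⟩ := Perm.exists_extending_pair ![p, q] ![a, b]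
    (by rw [← List.nodup_ofFn]; simp [hpq]) (by rw [← List.nodup_ofFn]; simp [hab])
  exact ⟨σ, hσ 0, hσ 1⟩

section Seed

variable {V : Type*} {A : Type*} [Ring A] (ψ : Perm V →* A) (p q : V) (e : A)

open Classical in
/-- The conjugate of `e` by a permutation moving `p` to `a` and `q` to `b`. -/
noncomputable def conjugateSeed (a b : V) : A :=
  if h : ∃ σ : Perm V, σ p = a ∧ σ q = b then ψ h.choose * e * ψ h.choose⁻¹ else 0

variable {ψ p q e}

theorem conjugateSeed_apply (he : ∀ τ : Perm V, τ p = p → τ q = q → Commute (ψ τ) e)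
    (σ : Perm V) : conjugateSeed ψ p q e (σ p) (σ q) = ψ σ * e * ψ σ⁻¹ := by
  have h : ∃ τ : Perm V, τ p = σ p ∧ τ q = σ q := ⟨σ, rfl, rfl⟩
  rw [conjugateSeed, dif_pos h]
  obtain ⟨h1, h2⟩ := h.choose_spec
  set τ := h.choose
  have hc := he (σ⁻¹ * τ) (by simp [h1]) (by simp [h2])
  calc ψ τ * e * ψ τ⁻¹ = ψ σ * (ψ (σ⁻¹ * τ) * e) * ψ τ⁻¹ := by
        rw [← mul_assoc, ← map_mul, mul_inv_cancel_left]
    _ = ψ σ * e * ψ σ⁻¹ := by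
        rw [hc.eq, ← mul_assoc, mul_assoc, ← map_mul, mul_inv_cancel_right]

theorem conjugateSeed_conj (hpq : p ≠ q)
    (he : ∀ τ : Perm V, τ p = p → τ q = q → Commute (ψ τ) e) (σ : Perm V) (a b : V) :
    ψ σ * conjugateSeed ψ p q e a b = conjugateSeed ψ p q e (σ a) (σ b) * ψ σ := by
  by_cases hab : a = b
  · have hz (c : V) : conjugateSeed ψ p q e c c = 0 := by
      rw [conjugateSeed, dif_neg]
      rintro ⟨τ, h1, h2⟩
      exact hpq (τ.injective (h1.trans h2.symm))
    rw [hab, hz, hz, mul_zero, zero_mul]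
  · obtain ⟨τ, rfl, rfl⟩ := exists_perm_apply_eq_and_apply_eq hpq hab
    rw [← Perm.mul_apply, ← Perm.mul_apply, conjugateSeed_apply he, conjugateSeed_apply he]
    simp only [mul_assoc, ← map_mul, mul_inv_rev, inv_mul_cancel, mul_one]
    simp only [← mul_assoc, ← map_mul]

end Seed

/-- The defining relations of the Brauer algebra of type `A_n`, for elements `R 0, …, R (n - 1)`
and `E 0, …, E (n - 1)`. -/
structure BrauerRelationsA {A : Type*} [Ring A] [Algebra Lp A] (n : ℕ) (R E : ℕ → A) : Prop
    extends CoxeterRelationsA n R where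
  E_sq : ∀ i, i < n → E i * E i = δpar • E i
  R_mul_E : ∀ i, i < n → R i * E i = E i
  E_mul_R : ∀ i, i < n → E i * R i = E i
  E_mul_R_far : ∀ i j, i + 2 ≤ j → j < n → E i * R j = R j * E i
  E_mul_E_far : ∀ i j, i + 2 ≤ j → j < n → E i * E j = E j * E i
  E_mul_E : ∀ i, i + 1 < n → R (i + 1) * R i * E (i + 1) = E i * E (i + 1)
  conj_E : ∀ i, i + 1 < n → R i * E (i + 1) * R i = R (i + 1) * E i * R (i + 1)

namespace BrauerRelationsA

open CoxeterRelationsA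

variable {A : Type*} [Ring A] [Algebra Lp A] {k : ℕ} {R E : ℕ → A}
  (h : BrauerRelationsA (k + 1) R E) {ψ : Perm (Fin (k + 2)) →* A}
  (hψ : ∀ i (hi : i < k + 1), ψ (adjSwap (k + 1) i hi) = R i)

include h hψ

theorem commute_swap {a b : ℕ} (ha : 2 ≤ a) (hab : a + 1 ≤ b) (hb : b < k + 2) :
    Commute (ψ (swap ⟨a, by omega⟩ ⟨b, hb⟩)) (E 0) := by
  induction b, hab using Nat.le_induction with
  | base =>
    have := hψ a (by omega)
    rw [adjSwap] at this
    rw [this]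
    exact (h.E_mul_R_far 0 a ha (by omega)).symm
  | succ b hab ih =>
    have h1 : Commute (ψ (swap ⟨b, by omega⟩ ⟨b + 1, hb⟩)) (E 0) := by
      have := hψ b (by omega)
      rw [adjSwap] at this
      rw [this]
      exact (h.E_mul_R_far 0 b (by omega) (by omega)).symm
    have h2 := swap_mul_swap_mul_swap (x := (⟨a, by omega⟩ : Fin (k + 2))) (y := ⟨b, by omega⟩)
      (z := ⟨b + 1, hb⟩) (by simp; omega) (by simp; omega)
    rw [swap_comm, ← h2, map_mul, map_mul]
    exact (h1.mul_left (ih (by omega))).mul_left h1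

theorem commute_of_fixed (τ : Perm (Fin (k + 2))) (h0 : τ 0 = 0) (h1 : τ 1 = 1) :
    Commute (ψ τ) (E 0) := by
  induction hn : τ.support.card using Nat.strong_induction_on generalizing τ with
  | _ n ih =>
  by_cases hτ : τ = 1
  · rw [hτ, map_one]
    exact Commute.one_left _
  obtain ⟨a, ha⟩ : ∃ a, τ a ≠ a := by
    by_contra! hall
    exact hτ (Equiv.ext hall)
  have hge {c : Fin (k + 2)} (hc0 : c ≠ 0) (hc1 : c ≠ 1) : 2 ≤ c.val := by
    have h0 : c.val ≠ 0 := fun e => hc0 (Fin.ext e)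
    have h1 : c.val ≠ 1 := fun e => hc1 (Fin.ext e)
    omega
  have ha0 : a ≠ 0 := fun e => ha (by rw [e, h0])
  have ha1 : a ≠ 1 := fun e => ha (by rw [e, h1])
  have hb0 : τ a ≠ 0 := fun e => ha0 (τ.injective (e.trans h0.symm))
  have hb1 : τ a ≠ 1 := fun e => ha1 (τ.injective (e.trans h1.symm))
  have hswap : Commute (ψ (swap a (τ a))) (E 0) := by
    rcases lt_or_gt_of_ne ha with hlt | hlt
    · rw [swap_comm]
      exact h.commute_swap hψ (hge hb0 hb1) hlt a.2
    · exact h.commute_swap hψ (hge ha0 ha1) hlt (τ a).2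
  have := ih _ (hn ▸ Perm.card_support_swap_mul ha) (swap a (τ a) * τ)
    (by rw [Perm.mul_apply, h0, swap_apply_of_ne_of_ne ha0.symm hb0.symm])
    (by rw [Perm.mul_apply, h1, swap_apply_of_ne_of_ne ha1.symm hb1.symm]) rfl
  have := hswap.mul_left this
  rwa [← map_mul, swap_mul_self_mul] at this

theorem conjugateSeed_adjacent (i : ℕ) (hi : i < k + 1) :
    conjugateSeed ψ 0 1 (E 0) ⟨i, by omega⟩ ⟨i + 1, by omega⟩ = E i := by
  have he := h.commute_of_fixed hψ
  induction i with
  | zero => simpa using conjugateSeed_apply he 1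
  | succ i ih =>
    have hconj := conjugateSeed_conj (by simp) he
      (adjSwap (k + 1) i (by omega) * adjSwap (k + 1) (i + 1) hi)
      ⟨i, by omega⟩ ⟨i + 1, by omega⟩
    have e1 : (adjSwap (k + 1) i (by omega) * adjSwap (k + 1) (i + 1) hi) ⟨i, by omega⟩ =
        ⟨i + 1, by omega⟩ := by
      simp [adjSwap, swap_apply_def]
      omega
    have e2 : (adjSwap (k + 1) i (by omega) * adjSwap (k + 1) (i + 1) hi) ⟨i + 1, by omega⟩ =
        ⟨i + 2, by omega⟩ := by
      simp [adjSwap, swap_apply_def]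
      omega
    rw [ih (by omega), e1, e2, map_mul, hψ, hψ] at hconj
    have s1 := h.sq i (by omega)
    have s2 := h.sq (i + 1) hi
    calc _ = conjugateSeed ψ 0 1 (E 0) ⟨i + 1, by omega⟩ ⟨i + 2, by omega⟩ *
          (R i * R (i + 1)) * (R (i + 1) * R i) := by
          rw [mul_assoc, mul_assoc (R i), ← mul_assoc (R (i + 1)), s2, one_mul, s1, mul_one]
      _ = R i * (R (i + 1) * E i * R (i + 1)) * R i := by
          rw [← hconj]
          simp only [mul_assoc]
      _ = E (i + 1) := by
          rw [← h.conj_E i hi, mul_assoc, mul_assoc, mul_assoc, s1, mul_one, ← mul_assoc, s1,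
            one_mul]

/-- The Brauer system on `k + 2` strands given by elements satisfying the type `A` relations. -/
noncomputable def brauerSystem : BrauerSystem (Fin (k + 2)) A :=
  have he := h.commute_of_fixed hψ
  have hconj := conjugateSeed_conj (by simp) he
  have hbase : conjugateSeed ψ 0 1 (E 0) 0 1 = E 0 := h.conjugateSeed_adjacent hψ 0 (by omega)
  have hψ0 : ψ (swap 0 1) = R 0 := hψ 0 (by omega)
  have transfer {x y : A} (σ : Perm (Fin (k + 2))) (hxy : x * ψ σ = y * ψ σ) : x = y := by
    simpa [mul_assoc, ← map_mul] using congrArg (· * ψ σ⁻¹) hxy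
  { ψ := ψ
    E := conjugateSeed ψ 0 1 (E 0)
    conj := hconj
    symm := fun a b => by
      by_cases hab : a = b
      · rw [hab]
      obtain ⟨σ, rfl, rfl⟩ :=
        exists_perm_apply_eq_and_apply_eq (p := (0 : Fin (k + 2))) (q := 1) (by simp) hab
      refine transfer σ ?_
      rw [← hconj, ← hconj]
      congr 1
      have := hconj (swap 0 1) 0 1
      rw [hbase, swap_apply_left, swap_apply_right, hψ0, h.R_mul_E 0 (by omega)] at this
      rw [hbase, ← mul_one (conjugateSeed _ _ _ _ _ _), ← h.sq 0 (by omega), ← mul_assoc, ← this,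
        h.E_mul_R 0 (by omega)]
    swap_mul := fun a b hab => by
      obtain ⟨σ, rfl, rfl⟩ :=
        exists_perm_apply_eq_and_apply_eq (p := (0 : Fin (k + 2))) (q := 1) (by simp) hab
      refine transfer σ ?_
      rw [mul_assoc, ← hconj, ← mul_assoc, ← map_mul, ← mul_swap_eq_swap_mul, map_mul, mul_assoc,
        hbase, hψ0, h.R_mul_E 0 (by omega)]
    sq := fun a b hab => by
      obtain ⟨σ, rfl, rfl⟩ :=
        exists_perm_apply_eq_and_apply_eq (p := (0 : Fin (k + 2))) (q := 1) (by simp) hab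
      refine transfer σ ?_
      rw [mul_assoc, ← hconj, ← mul_assoc, ← hconj, mul_assoc, hbase, h.E_sq 0 (by omega),
        smul_mul_assoc, ← hconj, hbase, mul_smul_comm]
    comm := fun a b c d hab hac had hbc hbd hcd => by
      have hy : Function.Injective ![a, b, c, d] := by
        rw [← List.nodup_ofFn]
        simp [*]
      have hk : 2 < k + 1 := by
        have := Fintype.card_le_of_injective _ hy
        simp only [Fintype.card_fin] at this
        omega
      obtain ⟨σ, hσ⟩ :=
        Perm.exists_extending_pair (Fin.castLE (by omega : _ ≤ k + 2)) _ (Fin.castLE_injective _) hy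
      have h0 : σ 0 = a := hσ 0
      have h1 : σ 1 = b := hσ 1
      have h2 : σ ⟨2, by omega⟩ = c := hσ 2
      have h3 : σ ⟨3, by omega⟩ = d := hσ 3
      rw [← h0, ← h1, ← h2, ← h3]
      refine transfer σ ?_
      have h2 := h.conjugateSeed_adjacent hψ 2 hk
      rw [mul_assoc, mul_assoc, ← hconj, ← hconj, ← mul_assoc, ← mul_assoc, ← hconj, ← hconj,
        mul_assoc, mul_assoc, hbase, h2, h.E_mul_E_far 0 2 le_rfl hk]
    mul_chain := fun a b c hab hbc hac => by
      have hy : Function.Injective ![a, b, c] := by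
        rw [← List.nodup_ofFn]
        simp [*]
      have hk : 1 < k + 1 := by
        have := Fintype.card_le_of_injective _ hy
        simp only [Fintype.card_fin] at this
        omega
      obtain ⟨σ, hσ⟩ :=
        Perm.exists_extending_pair (Fin.castLE (by omega : _ ≤ k + 2)) _ (Fin.castLE_injective _) hy
      have h0 : σ 0 = a := hσ 0
      have h1 : σ 1 = b := hσ 1
      have h2 : σ ⟨2, by omega⟩ = c := hσ 2
      rw [← h0, ← h1, ← h2]
      refine transfer σ ?_
      have h1 := h.conjugateSeed_adjacent hψ 1 hk
      have hs : ψ (swap 0 ⟨2, by omega⟩) = R 1 * R 0 * R 1 := by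
        rw [← hψ0, ← hψ 1 hk, ← map_mul, ← map_mul]
        congr 1
        have := swap_mul_swap_mul_swap (x := (0 : Fin (k + 2))) (y := 1) (z := ⟨2, by omega⟩)
          (by simp) (by simp [Fin.ext_iff])
        rw [swap_comm, ← this]
        rfl
      have h1' : conjugateSeed ψ 0 1 (E 0) 1 ⟨2, by omega⟩ = E 1 := h1
      rw [mul_assoc, mul_assoc, ← hconj, ← mul_assoc, ← mul_assoc, ← hconj, ← map_mul,
        ← mul_swap_eq_swap_mul, map_mul, mul_assoc, mul_assoc, hbase, h1', hs,
        mul_assoc (R 1 * R 0), h.R_mul_E 1 hk, h.E_mul_E 0 hk] }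

end BrauerRelationsA

namespace BrauerSystem

variable {V : Type*} [DecidableEq V] {A : Type*} [Ring A] [Algebra Lp A] (S : BrauerSystem V A)

theorem E_apply (σ : Perm V) (a b : V) : S.E (σ a) (σ b) = S.ψ σ * S.E a b * S.ψ σ⁻¹ := by
  rw [S.conj, mul_assoc, ← map_mul, mul_inv_cancel, map_one, mul_one]

theorem mul_swap {a b : V} (hab : a ≠ b) : S.E a b * S.ψ (swap a b) = S.E a b := by
  have h := S.conj (swap a b) a b
  rwa [S.swap_mul a b hab, swap_apply_left, swap_apply_right, S.symm b a, eq_comm] at h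

theorem E_mul_swap_of_ne {a b c d : V} (hac : a ≠ c) (had : a ≠ d) (hbc : b ≠ c) (hbd : b ≠ d) :
    S.E a b * S.ψ (swap c d) = S.ψ (swap c d) * S.E a b := by
  rw [S.conj, swap_apply_of_ne_of_ne hac had, swap_apply_of_ne_of_ne hbc hbd]

theorem swap_mul_swap_of_ne {a b c d : V} (hac : a ≠ c) (had : a ≠ d) (hbc : b ≠ c)
    (hbd : b ≠ d) : S.ψ (swap a b) * S.ψ (swap c d) = S.ψ (swap c d) * S.ψ (swap a b) := by
  rw [← map_mul, ← map_mul, swap_mul_eq_mul_swap, swap_inv, swap_apply_of_ne_of_ne hac had,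
    swap_apply_of_ne_of_ne hbc hbd]

section Triple

variable {a b c : V} (hab : a ≠ b) (hbc : b ≠ c) (hac : a ≠ c)

include hab hbc hac

theorem swap_braid : S.ψ (swap a b) * S.ψ (swap b c) * S.ψ (swap a b) =
    S.ψ (swap b c) * S.ψ (swap a b) * S.ψ (swap b c) := by
  simp only [← map_mul]
  rw [swap_mul_swap_mul_swap hab hac, swap_comm a b, swap_comm b c,
    swap_mul_swap_mul_swap hbc.symm hac.symm, swap_comm]

theorem swap_mul_swap_mul_E :
    S.ψ (swap b c) * S.ψ (swap a b) * S.E b c = S.E a b * S.E b c := by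
  rw [S.mul_chain a b c hab hbc hac]
  conv_lhs => rw [← S.swap_mul b c hbc]
  rw [← mul_assoc, ← map_mul, ← map_mul, swap_mul_swap_mul_swap hab hac, swap_comm]

theorem swap_mul_E_mul_swap : S.ψ (swap a b) * S.E b c * S.ψ (swap a b) =
    S.ψ (swap b c) * S.E a b * S.ψ (swap b c) := by
  have h1 := S.E_apply (swap a b) b c
  have h2 := S.E_apply (swap b c) a b
  rw [swap_inv, swap_apply_right, swap_apply_of_ne_of_ne hac.symm hbc.symm] at h1
  rw [swap_inv, swap_apply_left, swap_apply_of_ne_of_ne hab hac] at h2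
  rw [← h1, ← h2]

theorem E_mul_E_mul_E : S.E a b * S.E b c * S.E a b = S.E a b := by
  rw [mul_assoc, S.symm a b, S.symm b c, S.mul_chain c b a hbc.symm hab.symm hac.symm, S.symm b a,
    ← mul_assoc, swap_comm]
  have h := S.conj (swap a c) c b
  rw [swap_apply_right, swap_apply_of_ne_of_ne hab.symm hbc] at h
  rw [← h, mul_assoc, S.symm a b, S.mul_chain c b a hbc.symm hab.symm hac.symm, ← mul_assoc,
    ← map_mul, swap_comm c a, swap_mul_self, map_one, one_mul]

theorem E_mul_swap_mul_E : S.E a b * S.ψ (swap b c) * S.E a b = S.E a b := by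
  have h := S.conj (swap b c) a c
  rw [swap_apply_right, swap_apply_of_ne_of_ne hab hac] at h
  rw [← h, mul_assoc, S.symm a c, S.mul_chain c a b hac.symm hab hbc.symm, ← mul_assoc, ← map_mul,
    swap_comm c b, swap_mul_self, map_one, one_mul]

end Triple

section TypeB

variable {n : ℕ} (p : Fin (n + 1) ↪ V)

/-- The images of the generators of the Brauer algebra of type `B_n` in a Brauer system whose
strands contain `n + 1` chosen ones. -/
noncomputable def genB : BGen n → A
  | .r i => if i.val = 0 then 1 else S.ψ (swap (p i.castSucc) (p i.succ))
  | .e i => if i.val = 0 then δpar • S.E (p i.castSucc) (p i.succ)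
      else S.E (p i.castSucc) (p i.succ)

theorem lift_genB_rel {x y : FreeAlgebra Lp (BGen n)} (h : BrauerBRel n x y) :
    FreeAlgebra.lift Lp (S.genB p) x = FreeAlgebra.lift Lp (S.genB p) y := by
  have hsucc (i : Fin n) : p i.castSucc ≠ p i.succ := p.injective.ne (by simp [Fin.ext_iff])
  have hadj {i j : Fin n} (h : i.val + 1 = j.val) : p j.castSucc = p i.succ :=
    congrArg p (Fin.ext h.symm)
  have hne {i j : Fin n} (h : i.val + 1 = j.val) : p i.castSucc ≠ p j.succ :=
    p.injective.ne (by simp [Fin.ext_iff]; omega)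
  have hfar {i j : Fin n} (h : i.val + 2 ≤ j.val ∨ j.val + 2 ≤ i.val) :
      p i.castSucc ≠ p j.castSucc ∧ p i.castSucc ≠ p j.succ ∧ p i.succ ≠ p j.castSucc ∧
        p i.succ ≠ p j.succ := by
    refine ⟨?_, ?_, ?_, ?_⟩ <;> exact p.injective.ne (by simp [Fin.ext_iff]; omega)
  have htriple {i j : Fin n} (h0 : i.val = 0) (h1 : j.val = 1) :=
    hadj (show i.val + 1 = j.val by omega)
  cases h with
  | rr i =>
    simp only [map_mul, map_one, fr, FreeAlgebra.lift_ι_apply, genB]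
    split_ifs
    · rw [one_mul]
    · rw [← map_mul, swap_mul_self, map_one]
  | re i =>
    simp only [map_mul, fr, fe, FreeAlgebra.lift_ι_apply, genB]
    split_ifs
    · rw [one_mul]
    · exact S.swap_mul _ _ (hsucc i)
  | er i =>
    simp only [map_mul, fr, fe, FreeAlgebra.lift_ι_apply, genB]
    split_ifs
    · rw [mul_one]
    · exact S.mul_swap (hsucc i)
  | ee i h =>
    simp only [map_mul, map_smul, fe, FreeAlgebra.lift_ι_apply, genB, h.ne', if_false]
    exact S.sq _ _ (hsucc i)
  | e0e0 i h =>
    simp only [map_mul, map_smul, fe, FreeAlgebra.lift_ι_apply, genB, h, if_true,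
      smul_mul_smul_comm, S.sq _ _ (hsucc i)]
  | rrFar i j h =>
    obtain ⟨h1, h2, h3, h4⟩ := hfar h
    simp only [map_mul, fr, FreeAlgebra.lift_ι_apply, genB]
    split_ifs
    all_goals simp [S.swap_mul_swap_of_ne h1 h2 h3 h4]
  | erFar i j h =>
    obtain ⟨h1, h2, h3, h4⟩ := hfar h
    simp only [map_mul, fr, fe, FreeAlgebra.lift_ι_apply, genB]
    split_ifs
    all_goals simp [S.E_mul_swap_of_ne h1 h2 h3 h4]
  | eeFar i j h =>
    obtain ⟨h1, h2, h3, h4⟩ := hfar h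
    simp only [map_mul, fe, FreeAlgebra.lift_ι_apply, genB]
    split_ifs
    all_goals simp [S.comm _ _ _ _ (hsucc i) h1 h2 h3 h4 (hsucc j)]
  | braid i j h hi hj =>
    simp only [map_mul, fr, FreeAlgebra.lift_ι_apply, genB, hi.ne', hj.ne', if_false]
    rcases h with h | h
    · have := S.swap_braid (hsucc i) (hadj h ▸ hsucc j) (hne h)
      rwa [hadj h]
    · have := S.swap_braid (hsucc j) (hadj h ▸ hsucc i) (hne h)
      rw [hadj h, this]
  | rre i j h hi hj =>
    simp only [map_mul, fr, fe, FreeAlgebra.lift_ι_apply, genB, hi.ne', hj.ne', if_false]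
    rcases h with h | h
    · have := S.swap_mul_swap_mul_E (hsucc i) (hadj h ▸ hsucc j) (hne h)
      rwa [hadj h]
    · have := S.swap_mul_swap_mul_E (hadj h ▸ hsucc i).symm (hsucc j).symm (hne h).symm
      rwa [hadj h, S.symm (p j.castSucc), S.symm (p j.succ) (p i.succ), swap_comm (p j.castSucc),
        swap_comm (p j.succ) (p i.succ)]
  | rer i j h hi hj =>
    simp only [map_mul, fr, fe, FreeAlgebra.lift_ι_apply, genB, hi.ne', hj.ne', if_false]
    rcases h with h | h
    · have := S.swap_mul_E_mul_swap (hsucc i) (hadj h ▸ hsucc j) (hne h)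
      rwa [hadj h]
    · have := S.swap_mul_E_mul_swap (hsucc j) (hadj h ▸ hsucc i) (hne h)
      rw [hadj h, this]
  | b1010 i j h0 h1 => simp [fr, genB, h0]
  | b_r0r1e0 i j h0 h1 => simp [fr, fe, genB, h0]
  | b_r0e1r0e1 i j h0 h1 =>
    have hc := htriple h0 h1
    have := S.E_mul_E_mul_E (hsucc j).symm (hc ▸ (hsucc i).symm) (hne (by omega)).symm
    rw [hc] at this
    simp only [map_mul, fr, fe, FreeAlgebra.lift_ι_apply, genB, h0, h1, hc, if_true, one_ne_zero,
      if_false, one_mul, mul_one, S.sq _ _ (hc ▸ hsucc j), mul_smul_comm, smul_mul_assoc]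
    rw [S.symm (p i.succ), S.symm (p i.castSucc), this]
  | b_r0r1r0e1 i j h0 h1 =>
    simp [fr, fe, genB, h0, h1, S.swap_mul _ _ (hsucc j), S.mul_swap (hsucc j)]
  | b_e0r1e0 i j h0 h1 =>
    have hc := htriple h0 h1
    have := S.E_mul_swap_mul_E (hsucc i) (hc ▸ hsucc j) (hne (by omega))
    simp [fr, fe, genB, h0, h1, hc, this]
  | b_e0e1e0 i j h0 h1 =>
    have hc := htriple h0 h1
    have := S.E_mul_E_mul_E (hsucc i) (hc ▸ hsucc j) (hne (by omega))
    simp [fe, genB, h0, h1, hc, this]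
  | b_e0r1r0 i j h0 h1 => simp [fr, fe, genB, h0]
  | b_e0e1r0 i j h0 h1 => simp [fr, fe, genB, h0]

/-- The representation of the Brauer algebra of type `B_n` obtained from `n + 1` strands of a
Brauer system. -/
noncomputable def repB : BrauerB n →ₐ[Lp] A :=
  RingQuot.liftAlgHom Lp ⟨FreeAlgebra.lift Lp (S.genB p), fun _ _ h => S.lift_genB_rel p h⟩

theorem repB_mk_ι (x : BGen n) :
    S.repB p (RingQuot.mkAlgHom Lp (BrauerBRel n) (FreeAlgebra.ι Lp x)) = S.genB p x := by
  rw [repB, RingQuot.liftAlgHom_mkAlgHom_apply]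
  exact FreeAlgebra.lift_ι_apply _ _

end TypeB

end BrauerSystem

section TypeA

variable {V : Type} (G : SimpleGraph V)

theorem adjoin_gen_eq_top :
    Algebra.adjoin Lp (Set.range (genR G) ∪ Set.range (genE G)) = ⊤ := by
  have h := congrArg (Subalgebra.map (RingQuot.mkAlgHom Lp (BrauerQRel G)))
    (FreeAlgebra.adjoin_range_ι Lp (QGen V))
  rw [AlgHom.map_adjoin, Algebra.map_top,
    (AlgHom.range_eq_top _).2 (RingQuot.mkAlgHom_surjective Lp _)] at h
  rw [← h]
  congr 1
  ext x
  constructor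
  · rintro (⟨i, rfl⟩ | ⟨i, rfl⟩)
    exacts [⟨_, ⟨QGen.R i, rfl⟩, rfl⟩, ⟨_, ⟨QGen.E i, rfl⟩, rfl⟩]
  · rintro ⟨_, ⟨i | i, rfl⟩, rfl⟩
    exacts [Or.inl ⟨i, rfl⟩, Or.inr ⟨i, rfl⟩]

theorem Agraph_adj {m : ℕ} {i j : Fin m} :
    (Agraph m).Adj i j ↔ i.val + 1 = j.val ∨ j.val + 1 = i.val := by
  simp only [Agraph, SimpleGraph.fromRel_adj, ne_eq, Fin.ext_iff]
  omega

/-- The generators `R i` of `Br(A_m)`, indexed by natural numbers. -/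
noncomputable def pathR (m i : ℕ) : BrauerQ (Agraph m) :=
  if h : i < m then genR (Agraph m) ⟨i, h⟩ else 1

/-- The generators `E i` of `Br(A_m)`, indexed by natural numbers. -/
noncomputable def pathE (m i : ℕ) : BrauerQ (Agraph m) :=
  if h : i < m then genE (Agraph m) ⟨i, h⟩ else 1

theorem brauerRelationsA_path (m : ℕ) : BrauerRelationsA m (pathR m) (pathE m) := by
  have hR {i : ℕ} (hi : i < m) : pathR m i = genR (Agraph m) ⟨i, hi⟩ := dif_pos hi
  have hE {i : ℕ} (hi : i < m) : pathE m i = genE (Agraph m) ⟨i, hi⟩ := dif_pos hi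
  have rel {x y} (h : BrauerQRel (Agraph m) x y) := RingQuot.mkAlgHom_rel Lp h
  have adj {i : ℕ} (hi : i + 1 < m) :
      (Agraph m).Adj ⟨i, Nat.lt_of_succ_lt hi⟩ ⟨i + 1, hi⟩ := Agraph_adj.2 (Or.inl rfl)
  have ne {i j : ℕ} (hij : i + 2 ≤ j) (hj : j < m) :
      (⟨i, by omega⟩ : Fin m) ≠ ⟨j, hj⟩ := by simp; omega
  have far {i j : ℕ} (hij : i + 2 ≤ j) (hj : j < m) :
      ¬ (Agraph m).Adj ⟨i, by omega⟩ ⟨j, hj⟩ := by rw [Agraph_adj]; simp; omega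
  constructor
  · constructor
    · intro i hi
      simpa [hR hi, genR] using rel (.RR ⟨i, hi⟩)
    · intro i hi
      simpa [hR hi, hR (Nat.lt_of_succ_lt hi), genR] using rel (.braid _ _ (adj hi))
    · intro i j hij hj
      simpa [hR hj, hR (show i < m by omega), genR] using rel (.RRfar _ _ (ne hij hj) (far hij hj))
  · intro i hi
    simpa [hE hi, genE] using rel (.EE ⟨i, hi⟩)
  · intro i hi
    simpa [hR hi, hE hi, genR, genE] using rel (.RE ⟨i, hi⟩)
  · intro i hi
    simpa [hR hi, hE hi, genR, genE] using rel (.ER ⟨i, hi⟩)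
  · intro i j hij hj
    simpa [hR hj, hE (show i < m by omega), genR, genE] using
      rel (.ERfar _ _ (ne hij hj) (far hij hj))
  · intro i j hij hj
    simpa [hE hj, hE (show i < m by omega), genE] using
      rel (.EEfar _ _ (ne hij hj) (far hij hj))
  · intro i hi
    simpa [hR hi, hR (Nat.lt_of_succ_lt hi), hE hi, hE (Nat.lt_of_succ_lt hi), genR, genE] using
      rel (.RRE _ _ (adj hi))
  · intro i hi
    simpa [hR hi, hR (Nat.lt_of_succ_lt hi), hE hi, hE (Nat.lt_of_succ_lt hi), genR, genE] using
      rel (.RER _ _ (adj hi))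

end TypeA

/-- The homomorphism `Br(A_m) → Br(B_{m+1})` sending `R j` to `r (j + 1)` and `E j` to
`e (j + 1)`. -/
noncomputable def pathToB (m : ℕ) : BrauerQ (Agraph m) →ₐ[Lp] BrauerB (m + 1) :=
  RingQuot.liftAlgHom Lp ⟨FreeAlgebra.lift Lp fun
    | .R j => rb (m + 1) (j.val + 1)
    | .E j => eb (m + 1) (j.val + 1), by
    have hr (j : Fin m) : rb (m + 1) (j.val + 1) = RingQuot.mkAlgHom Lp _ (fr j.succ) :=
      dif_pos j.succ.2
    have he (j : Fin m) : eb (m + 1) (j.val + 1) = RingQuot.mkAlgHom Lp _ (fe j.succ) :=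
      dif_pos j.succ.2
    have rel {x y} (h : BrauerBRel (m + 1) x y) := RingQuot.mkAlgHom_rel Lp h
    have pos (j : Fin m) : 0 < j.succ.val := Nat.succ_pos _
    have adj {i j : Fin m} (h : (Agraph m).Adj i j) :
        i.succ.val + 1 = j.succ.val ∨ j.succ.val + 1 = i.succ.val := by
      rw [Agraph_adj] at h
      simp only [Fin.val_succ]
      omega
    have far {i j : Fin m} (hne : i ≠ j) (h : ¬ (Agraph m).Adj i j) :
        i.succ.val + 2 ≤ j.succ.val ∨ j.succ.val + 2 ≤ i.succ.val := by
      rw [Agraph_adj] at h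
      rw [ne_eq, Fin.ext_iff] at hne
      simp only [Fin.val_succ]
      omega
    intro x y h
    cases h with
    | RR i => simpa [fR, hr] using rel (.rr i.succ)
    | EE i => simpa [fE, he] using rel (.ee i.succ (pos i))
    | RE i => simpa [fR, fE, hr, he] using rel (.re i.succ)
    | ER i => simpa [fR, fE, hr, he] using rel (.er i.succ)
    | RRfar i j hne h => simpa [fR, hr] using rel (.rrFar _ _ (far hne h))
    | ERfar i j hne h => simpa [fR, fE, hr, he] using rel (.erFar _ _ (far hne h))
    | EEfar i j hne h => simpa [fE, he] using rel (.eeFar _ _ (far hne h))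
    | braid i j h => simpa [fR, hr] using rel (.braid _ _ (adj h) (pos i) (pos j))
    | RRE i j h => simpa [fR, fE, hr, he] using rel (.rre _ _ (adj h) (pos i) (pos j))
    | RER i j h => simpa [fR, fE, hr, he] using rel (.rer _ _ (adj h) (pos i) (pos j))⟩

theorem pathToB_genR {m : ℕ} (j : Fin m) :
    pathToB m (genR (Agraph m) j) = rb (m + 1) (j.val + 1) := by
  rw [pathToB, genR, RingQuot.liftAlgHom_mkAlgHom_apply]
  exact FreeAlgebra.lift_ι_apply _ _

theorem pathToB_genE {m : ℕ} (j : Fin m) :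
    pathToB m (genE (Agraph m) j) = eb (m + 1) (j.val + 1) := by
  rw [pathToB, genE, RingQuot.liftAlgHom_mkAlgHom_apply]
  exact FreeAlgebra.lift_ι_apply _ _

theorem pathToB_range (m : ℕ) : (pathToB m).range = Algebra.adjoin Lp
    {x : BrauerB (m + 1) | ∃ i : ℕ, 1 ≤ i ∧ i < m + 1 ∧ (x = rb (m + 1) i ∨ x = eb (m + 1) i)} := by
  rw [← Algebra.map_top, ← adjoin_gen_eq_top, AlgHom.map_adjoin]
  congr 1
  ext x
  constructor
  · rintro ⟨_, ⟨j, rfl⟩ | ⟨j, rfl⟩, rfl⟩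
    · exact ⟨j + 1, by omega, by omega, Or.inl (pathToB_genR j)⟩
    · exact ⟨j + 1, by omega, by omega, Or.inr (pathToB_genE j)⟩
  · rintro ⟨i, hi, him, rfl | rfl⟩ <;> obtain ⟨i, rfl⟩ := Nat.exists_eq_add_of_le' hi
    · exact ⟨_, Or.inl ⟨⟨i, by omega⟩, rfl⟩, pathToB_genR _⟩
    · exact ⟨_, Or.inr ⟨⟨i, by omega⟩, rfl⟩, pathToB_genE _⟩

/-- The points of the matchings on which `Br(B_n)` acts: an upper and a lower copy of `V`, and two
further points. -/
abbrev MatchingPoints (V : Type*) : Type _ := V ⊕ (V ⊕ Bool)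

namespace MatchingPoints

/-- The involution exchanging the two copies of `V` and the two further points. -/
def vertical (V : Type*) : MatchingPoints V → MatchingPoints V
  | .inl a => .inr (.inl a)
  | .inr (.inl a) => .inl a
  | .inr (.inr b) => .inr (.inr !b)

theorem vertical_involutive (V : Type*) : Function.Involutive (vertical V) := by
  rintro (a | a | b) <;> simp [vertical]

/-- The perfect matching joining the two copies of each element of `V`. -/
def verticalMatching (V : Type*) : PerfectMatching (MatchingPoints V) :=
  ⟨(vertical_involutive V).toPerm, vertical_involutive V, by
    rintro (a | a | b) <;> simp [vertical]⟩

/-- The points at which the generators of `Br(B_n)` act: a further point followed by the upper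
copy of `Fin m`. -/
def strands (m : ℕ) : Fin (m + 1) ↪ MatchingPoints (Fin m) :=
  ⟨Fin.cons (.inr (.inr false)) .inl, Fin.cons_injective_iff.2 ⟨by simp, Sum.inl_injective⟩⟩

end MatchingPoints

open MatchingPoints in
theorem exists_matchingAction (k : ℕ) {ψ : Perm (Fin (k + 2)) →* BrauerQ (Agraph (k + 1))}
    (hψ : ∀ i (hi : i < k + 1), ψ (CoxeterRelationsA.adjSwap (k + 1) i hi) = pathR (k + 1) i) :
    ∃ Θ : ((brauerRelationsA_path (k + 1)).brauerSystem hψ).MatchingAction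
        (MatchingPoints (Fin (k + 2))),
      Θ.Φ = ((PerfectMatching.brauerSystem _).repB (strands (k + 2))).comp (pathToB (k + 1)) := by
  set S := (brauerRelationsA_path (k + 1)).brauerSystem hψ with hS
  set S' := PerfectMatching.brauerSystem (MatchingPoints (Fin (k + 2)))
  let Φ := (S'.repB (strands (k + 2))).comp (pathToB (k + 1))
  let g : Perm (Fin (k + 2)) →* Perm (MatchingPoints (Fin (k + 2))) :=
    (Perm.sumCongrHom _ _).comp (MonoidHom.inl _ _)
  have hg (σ : Perm (Fin (k + 2))) : g σ = Perm.sumCongr σ 1 := rfl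
  have hR (i : ℕ) (hi : i < k + 1) : Φ (pathR (k + 1) i) =
      S'.ψ (swap (.inl ⟨i, by omega⟩) (.inl ⟨i + 1, by omega⟩)) := by
    simp only [Φ, AlgHom.comp_apply, pathR, dif_pos hi, pathToB_genR, rb]
    rw [dif_pos (by omega)]
    exact S'.repB_mk_ι _ _
  have hE (i : ℕ) (hi : i < k + 1) : Φ (pathE (k + 1) i) =
      S'.E (.inl ⟨i, by omega⟩) (.inl ⟨i + 1, by omega⟩) := by
    simp only [Φ, AlgHom.comp_apply, pathE, dif_pos hi, pathToB_genE, eb]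
    rw [dif_pos (by omega)]
    exact S'.repB_mk_ι _ _
  have map_ψ (σ : Perm (Fin (k + 2))) : Φ (S.ψ σ) = S'.ψ (g σ) := by
    induction σ using CoxeterRelationsA.adjSwap_induction with
    | one => simp
    | mul i hi π ih =>
      rw [map_mul, map_mul, map_mul, map_mul, ih]
      congr 1
      refine (congrArg Φ (hψ i hi)).trans ((hR i hi).trans ?_)
      rw [hg, CoxeterRelationsA.adjSwap, Perm.sumCongr_swap_one]
  have map_E (a b : Fin (k + 2)) (hab : a ≠ b) : Φ (S.E a b) = S'.E (.inl a) (.inl b) := by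
    obtain ⟨σ, rfl, rfl⟩ :=
      exists_perm_apply_eq_and_apply_eq (p := (0 : Fin (k + 2))) (q := 1) (by simp) hab
    have h0 : S.E 0 1 = pathE (k + 1) 0 :=
      (brauerRelationsA_path (k + 1)).conjugateSeed_adjacent hψ 0 (by omega)
    rw [S.E_apply, map_mul, map_mul, map_ψ, map_ψ, h0, hE 0 (by omega), map_inv, ← S'.E_apply]
    rfl
  exact ⟨{
    Φ := Φ
    g := g
    ι := .inl
    κ := fun a => .inr (.inl a)
    ι_injective := Sum.inl_injective
    κ_injective := Sum.inr_injective.comp Sum.inl_injective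
    ι_ne_κ := by simp
    g_ι := fun _ _ => rfl
    g_κ := fun _ _ => rfl
    map_ψ := map_ψ
    map_E := map_E
    base := verticalMatching _
    base_ι := fun _ => rfl }, rfl⟩

theorem pathToB_injective (k : ℕ) : Function.Injective (pathToB (k + 1)) := by
  have hrel := brauerRelationsA_path (k + 1)
  obtain ⟨ψ, hψ⟩ := hrel.exists_hom
  obtain ⟨Θ, hΘ⟩ := exists_matchingAction k hψ
  have hgen : Algebra.adjoin Lp (hrel.brauerSystem hψ).generators = ⊤ := by
    rw [eq_top_iff, ← adjoin_gen_eq_top]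
    refine Algebra.adjoin_mono ?_
    rintro _ (⟨i, rfl⟩ | ⟨i, rfl⟩)
    · exact Or.inl ⟨_, (hψ i i.2).trans (dif_pos i.2)⟩
    · exact Or.inr ⟨⟨i, by omega⟩, ⟨i + 1, by omega⟩, by simp,
        ((hrel.conjugateSeed_adjacent hψ i i.2).trans (dif_pos i.2)).symm⟩
  have := Θ.injective hgen
  rw [hΘ, AlgHom.coe_comp] at this
  exact this.of_comp

end BrauerMonomials

/-- For `n ≥ 2`, the `ℤ[δ,δ⁻¹]`-subalgebra of `Br(B_n)` generated by
`r_1, …, r_{n-1}, e_1, …, e_{n-1}` is isomorphic to the Brauer algebra `Br(A_{n-1})`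
via the map sending the generators `R_i ↦ r_i`, `E_i ↦ e_i` (vertex `j` of `A_{n-1}`
here corresponds to the node `j+1`). -/
theorem statement_6 (n : ℕ) (hn : 2 ≤ n) :
    ∃ φ : BrauerQ (Agraph (n - 1)) →ₐ[Lp] BrauerB n,
      (∀ j : Fin (n - 1),
        φ (genR (Agraph (n - 1)) j) = rb n (j.val + 1) ∧
        φ (genE (Agraph (n - 1)) j) = eb n (j.val + 1)) ∧
      Function.Injective φ ∧
      φ.range = Algebra.adjoin Lp
        {x : BrauerB n | ∃ i : ℕ, 1 ≤ i ∧ i < n ∧ (x = rb n i ∨ x = eb n i)} := by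
  obtain ⟨k, rfl⟩ := Nat.exists_eq_add_of_le' hn
  exact ⟨pathToB (k + 1), fun j => ⟨pathToB_genR j, pathToB_genE j⟩, pathToB_injective k,
    pathToB_range (k + 1)⟩
end
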